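/- There exists a constant C > 0 such that for every statistics parameter α ∈ [0,1] and every integer N ≥ 1, the Dirichlet ground-state energy of N ideal anyons on the unit square satisfies E^D_N(α) ≤ C (N + α N²). -/

import Mathlib

noncomputable section

open MeasureTheory Real Set
open scoped BigOperators Topology

/-- The plane `ℝ²`, with points written as pairs. -/
abbrev Plane : Type := ℝ × ℝ

/-- Configuration space of `N` particles in the plane. -/
abbrev Config (N : ℕ) : Type := Fin N → Plane

/-- `x^{-⊥} := (-y, x)/(x² + y²)` for `x = (x, y) ∈ ℝ²`. -/
def perpInv (v : Plane) : Plane :=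
  (-v.2 / (v.1 ^ 2 + v.2 ^ 2), v.1 / (v.1 ^ 2 + v.2 ^ 2))

/-- The Aharonov–Bohm potential `A_j(x) = ∑_{k ≠ j} (x_j - x_k)^{-⊥}`. -/
def abPot (N : ℕ) (j : Fin N) (x : Config N) : Plane :=
  ∑ k ∈ Finset.univ.erase j, perpInv (x j - x k)

/-- Partial derivative of `Ψ` at `x` in direction `v` of the `j`-th particle. -/
def pder (N : ℕ) (j : Fin N) (v : Plane) (Ψ : Config N → ℂ) (x : Config N) : ℂ :=
  fderiv ℝ Ψ x (Pi.single j v)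

/-- The two components of `D_j Ψ = -i ∇_{x_j} Ψ + α A_j Ψ` at `x`. -/
def DOp (N : ℕ) (α : ℝ) (j : Fin N) (Ψ : Config N → ℂ) (x : Config N) : ℂ × ℂ :=
  (-Complex.I * pder N j (1, 0) Ψ x + Complex.ofReal (α * (abPot N j x).1) * Ψ x,
   -Complex.I * pder N j (0, 1) Ψ x + Complex.ofReal (α * (abPot N j x).2) * Ψ x)

/-- `|D_j Ψ(x)|²`, the squared Euclidean norm of the vector `D_j Ψ(x) ∈ ℂ²`. -/
def DSq (N : ℕ) (α : ℝ) (j : Fin N) (Ψ : Config N → ℂ) (x : Config N) : ℝ :=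
  ‖(DOp N α j Ψ x).1‖ ^ 2 + ‖(DOp N α j Ψ x).2‖ ^ 2

/-- The diagonal set `{x : x_j = x_k for some j ≠ k}`. -/
def diagSet (N : ℕ) : Set (Config N) := {x | ∃ j k : Fin N, j ≠ k ∧ x j = x k}

/-- Admissible wave functions: smooth, symmetric, vanishing on a neighbourhood of
the diagonal set. -/
structure Admissible (N : ℕ) (Ψ : Config N → ℂ) : Prop where
  smooth : ContDiff ℝ (⊤ : ℕ∞) Ψ
  symm : ∀ (σ : Equiv.Perm (Fin N)) (x : Config N), Ψ (x ∘ σ) = Ψ x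
  vanishes : ∃ U : Set (Config N), IsOpen U ∧ diagSet N ⊆ U ∧ ∀ x ∈ U, Ψ x = 0

/-- `Ω^N` as a subset of configuration space. -/
def cube (N : ℕ) (Ω : Set Plane) : Set (Config N) := Set.univ.pi fun _ => Ω

/-- Total kinetic energy `∑_j ∫_{Ω^N} |D_j Ψ|²`. -/
def kinE (N : ℕ) (α : ℝ) (Ω : Set Plane) (Ψ : Config N → ℂ) : ℝ :=
  ∑ j, ∫ x in cube N Ω, DSq N α j Ψ x

/-- `∫_{Ω^N} |Ψ|²`. -/
def normSq (N : ℕ) (Ω : Set Plane) (Ψ : Config N → ℂ) : ℝ :=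
  ∫ x in cube N Ω, ‖Ψ x‖ ^ 2

/-- Neumann ground-state energy of `N` anyons with statistics parameter `α` on `Ω`,
with the convention that it is `0` for `N = 0`. -/
def neumannE (N : ℕ) (α : ℝ) (Ω : Set Plane) : ℝ :=
  if N = 0 then 0 else
    sInf {E | ∃ Ψ : Config N → ℂ, Admissible N Ψ ∧ normSq N Ω Ψ = 1 ∧ E = kinE N α Ω Ψ}

/-- Dirichlet ground-state energy of `N` anyons with statistics parameter `α` on `Ω`. -/
def dirichletE (N : ℕ) (α : ℝ) (Ω : Set Plane) : ℝ :=
  sInf {E | ∃ Ψ : Config N → ℂ, Admissible N Ψ ∧ IsCompact (tsupport Ψ) ∧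
    tsupport Ψ ⊆ cube N Ω ∧ normSq N Ω Ψ = 1 ∧ E = kinE N α Ω Ψ}

/-- The open unit square `Q₀ = (0,1)²`. -/
def Q0 : Set Plane := Set.Ioo (0 : ℝ) 1 ×ˢ Set.Ioo (0 : ℝ) 1

/-- `E^N_N(α)`, the Neumann energy on the unit square. -/
def EN (N : ℕ) (α : ℝ) : ℝ := neumannE N α Q0

/-- `E^D_N(α)`, the Dirichlet energy on the unit square. -/
def ED (N : ℕ) (α : ℝ) : ℝ := dirichletE N α Q0

/-- One-particle density `ρ_Ψ` of a wave function of `n+1` particles. -/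
def density (n : ℕ) (Ψ : Config (n + 1) → ℂ) (y : Plane) : ℝ :=
  (n + 1) * ∫ z : Config n, ‖Ψ (Fin.cons y z)‖ ^ 2

/-! ### One-variable cutoffs -/

/-- The derivative of the smooth transition function is bounded. -/
lemma smT_deriv_bound : ∃ K : ℝ, 1 ≤ K ∧ ∀ x : ℝ, |deriv Real.smoothTransition x| ≤ K := by
  have hc : Continuous (deriv Real.smoothTransition) :=
    (Real.smoothTransition.contDiff (n := 1)).continuous_deriv le_rfl
  obtain ⟨K, hK⟩ := (isCompact_Icc (a := (0:ℝ)) (b := 1)).exists_bound_of_continuousOn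
    hc.continuousOn
  refine ⟨max K 1, le_max_right _ _, fun x => ?_⟩
  by_cases hx : x ∈ Icc (0:ℝ) 1
  · exact (hK x hx).trans (le_max_left _ _)
  · have h0 : deriv Real.smoothTransition x = 0 := by
      rw [mem_Icc, not_and_or, not_le, not_le] at hx
      rcases hx with hx | hx
      · have : Real.smoothTransition =ᶠ[𝓝 x] fun _ => (0:ℝ) := by
          filter_upwards [Iio_mem_nhds hx] with y hy
          exact Real.smoothTransition.zero_of_nonpos (le_of_lt hy)
        rw [this.deriv_eq]; simp
      · have : Real.smoothTransition =ᶠ[𝓝 x] fun _ => (1:ℝ) := by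
          filter_upwards [Ioi_mem_nhds hx] with y hy
          exact Real.smoothTransition.one_of_one_le (le_of_lt hy)
        rw [this.deriv_eq]; simp
    rw [h0]; simp

lemma smT_hasDerivAt (x : ℝ) :
    HasDerivAt Real.smoothTransition (deriv Real.smoothTransition x) x :=
  ((Real.smoothTransition.contDiff (n := 1)).differentiable (by norm_num) x).hasDerivAt

/-- Periodic one-dimensional cutoff restricted to `(0,1)`. -/
def pf (m : ℕ) (t : ℝ) : ℝ :=
  if 0 < t ∧ t < 1 then Real.smoothTransition (8 * Real.sin (π * m * t) ^ 2 - 1) else 0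

/-- The good set containing the support of `pf`. -/
def Gd (m : ℕ) : Set ℝ := {t | (0 ≤ t ∧ t ≤ 1) ∧ 1 / 8 ≤ Real.sin (π * m * t) ^ 2}

lemma Gd_closed (m : ℕ) : IsClosed (Gd m) := by
  unfold Gd
  have h1 : IsClosed {t : ℝ | 0 ≤ t} := isClosed_le continuous_const continuous_id
  have h2 : IsClosed {t : ℝ | t ≤ 1} := isClosed_le continuous_id continuous_const
  have h3 : IsClosed {t : ℝ | 1 / 8 ≤ Real.sin (π * m * t) ^ 2} :=
    isClosed_le continuous_const (by fun_prop)
  exact (h1.inter h2).inter h3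

lemma Gd_subset (m : ℕ) {t : ℝ} (ht : t ∈ Gd m) : 0 < t ∧ t < 1 := by
  obtain ⟨⟨h0, h1⟩, h2⟩ := ht
  refine ⟨lt_of_le_of_ne h0 ?_, lt_of_le_of_ne h1 ?_⟩
  · rintro rfl
    norm_num at h2
  · rintro rfl
    rw [mul_one, mul_comm, Real.sin_nat_mul_pi] at h2
    norm_num at h2

lemma Gd_not_int (m : ℕ) {t : ℝ} (ht : t ∈ Gd m) (n : ℤ) : (m : ℝ) * t ≠ n := by
  obtain ⟨_, h2⟩ := ht
  intro h
  rw [mul_assoc, h, mul_comm, Real.sin_int_mul_pi] at h2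
  norm_num at h2

/-- The floor of `m t` is locally constant at points of the good set. -/
lemma floor_ev (m : ℕ) {t : ℝ} (ht : t ∈ Gd m) :
    ∀ᶠ s in 𝓝 t, ⌊(m : ℝ) * s⌋ = ⌊(m : ℝ) * t⌋ := by
  have h1 : (⌊(m : ℝ) * t⌋ : ℝ) < m * t :=
    lt_of_le_of_ne (Int.floor_le _) (fun h => Gd_not_int m ht _ h.symm)
  have h2 : (m : ℝ) * t < ⌊(m : ℝ) * t⌋ + 1 := Int.lt_floor_add_one _
  have hc : Continuous fun s : ℝ => (m : ℝ) * s := by fun_prop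
  filter_upwards [hc.continuousAt.eventually (Ioo_mem_nhds h1 h2)] with s hs
  rw [Int.floor_eq_iff]
  exact ⟨hs.1.le, hs.2⟩

lemma pf_zero (m : ℕ) {t : ℝ} (ht : t ∉ Gd m) : pf m t = 0 := by
  unfold pf
  split_ifs with h
  · apply Real.smoothTransition.zero_of_nonpos
    by_contra hc
    exact ht ⟨⟨h.1.le, h.2.le⟩, by linarith⟩
  · rfl

lemma pf_ev_zero (m : ℕ) {t : ℝ} (ht : t ∉ Gd m) : pf m =ᶠ[𝓝 t] fun _ => 0 := by
  filter_upwards [(Gd_closed m).isOpen_compl.mem_nhds ht] with s hs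
  exact pf_zero m hs

lemma pf_ev (m : ℕ) {t : ℝ} (ht : t ∈ Gd m) :
    pf m =ᶠ[𝓝 t] fun t => Real.smoothTransition (8 * Real.sin (π * m * t) ^ 2 - 1) := by
  obtain ⟨h0, h1⟩ := Gd_subset m ht
  filter_upwards [Ioo_mem_nhds h0 h1] with s hs
  unfold pf
  rw [if_pos ⟨hs.1, hs.2⟩]

lemma pf_contDiff (m : ℕ) : ContDiff ℝ (⊤ : ℕ∞) (pf m) := by
  rw [contDiff_iff_contDiffAt]
  intro t
  by_cases ht : t ∈ Gd m
  · refine ContDiffAt.congr_of_eventuallyEq ?_ (pf_ev m ht)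
    apply ContDiff.contDiffAt
    exact (Real.smoothTransition.contDiff).comp (by fun_prop)
  · exact contDiffAt_const.congr_of_eventuallyEq (pf_ev_zero m ht)

lemma pf_nonneg (m : ℕ) (t : ℝ) : 0 ≤ pf m t := by
  unfold pf; split_ifs
  · exact Real.smoothTransition.nonneg _
  · exact le_rfl

lemma pf_le_one (m : ℕ) (t : ℝ) : pf m t ≤ 1 := by
  unfold pf; split_ifs
  · exact Real.smoothTransition.le_one _
  · exact zero_le_one

lemma pf_deriv (m : ℕ) {K : ℝ} (hK : ∀ x : ℝ, |deriv Real.smoothTransition x| ≤ K) (t : ℝ) :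
    ∃ d : ℝ, HasDerivAt (pf m) d t ∧ |d| ≤ 16 * π * K * m := by
  have hK0 : 0 ≤ K := (abs_nonneg _).trans (hK 0)
  have hpi := Real.pi_pos
  by_cases ht : t ∈ Gd m
  · have h1 : HasDerivAt (fun t : ℝ => 8 * Real.sin (π * m * t) ^ 2 - 1)
        (8 * (2 * Real.sin (π * m * t) * (Real.cos (π * m * t) * (π * m)))) t := by
      have := (((((hasDerivAt_id t).const_mul (π * m)).sin).pow 2).const_mul 8).sub_const 1
      simpa using this
    refine ⟨_, ((smT_hasDerivAt _).comp t h1).congr_of_eventuallyEq (pf_ev m ht), ?_⟩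
    rw [abs_mul]
    have h2 : |8 * (2 * Real.sin (π * m * t) * (Real.cos (π * m * t) * (π * m)))|
        ≤ 16 * π * m := by
      have e : 8 * (2 * Real.sin (π * m * t) * (Real.cos (π * m * t) * (π * m))) =
        (16 * π * m) * (Real.sin (π * m * t) * Real.cos (π * m * t)) := by ring
      rw [e, abs_mul, abs_mul (Real.sin _), abs_of_nonneg (by positivity : (0:ℝ) ≤ 16 * π * m)]
      have := Real.abs_sin_le_one (π * m * t)
      have := Real.abs_cos_le_one (π * m * t)
      have h3 : |Real.sin (π * m * t)| * |Real.cos (π * m * t)| ≤ 1 :=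
        mul_le_one₀ (by assumption) (abs_nonneg _) (by assumption)
      calc _ ≤ 16 * π * m * 1 := by gcongr
        _ = _ := mul_one _
    calc _ ≤ K * (16 * π * m) := mul_le_mul (hK _) h2 (abs_nonneg _) hK0
      _ = _ := by ring
  · exact ⟨0, (hasDerivAt_const t (0:ℝ)).congr_of_eventuallyEq (pf_ev_zero m ht), by
      rw [abs_zero]; positivity⟩

lemma pf_int (m : ℕ) (hm : 1 ≤ m) :
    ENNReal.ofReal (1 / 3) ≤ ∫⁻ t in Ioo (0:ℝ) 1, ENNReal.ofReal (pf m t ^ 2) := by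
  have hm0 : (0:ℝ) < m := by exact_mod_cast hm
  have hlow : ∀ t ∈ Ioo (0:ℝ) 1, (4 / 3) * (Real.sin (π * m * t) ^ 2 - 1 / 4) ≤ pf m t ^ 2 := by
    intro t ht
    by_cases h : 1 / 4 ≤ Real.sin (π * m * t) ^ 2
    · have : pf m t = 1 := by
        unfold pf
        rw [if_pos ⟨ht.1, ht.2⟩]
        exact Real.smoothTransition.one_of_one_le (by linarith)
      rw [this]
      have := Real.sin_sq_le_one (π * m * t)
      linarith
    · have := sq_nonneg (pf m t)
      linarith
  have hval : ∫ t in (0:ℝ)..1, (4 / 3) * (Real.sin (π * m * t) ^ 2 - 1 / 4) = 1 / 3 := by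
    have hne : π * (m:ℝ) ≠ 0 := by positivity
    rw [intervalIntegral.integral_const_mul, intervalIntegral.integral_sub
      (Continuous.intervalIntegrable (by fun_prop) _ _) (by simp)]
    rw [intervalIntegral.integral_comp_mul_left (fun x => Real.sin x ^ 2) hne, integral_sin_sq]
    have : Real.sin (π * m * 1) = 0 := by rw [mul_one, mul_comm, Real.sin_nat_mul_pi]
    rw [this]
    simp
    field_simp
    norm_num
  rw [intervalIntegral.integral_of_le zero_le_one, integral_Ioc_eq_integral_Ioo] at hval
  rw [← hval]
  have hi : Integrable (fun t : ℝ => pf m t ^ 2) (volume.restrict (Ioo (0:ℝ) 1)) := by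
    have : Continuous fun t : ℝ => pf m t ^ 2 := ((pf_contDiff m).continuous).pow 2
    exact (this.integrableOn_Icc (a := 0) (b := 1)).mono_set Ioo_subset_Icc_self
  rw [← ofReal_integral_eq_lintegral_ofReal hi (Filter.Eventually.of_forall fun _ => sq_nonneg _)]
  apply ENNReal.ofReal_le_ofReal
  apply setIntegral_mono_on _ hi measurableSet_Ioo hlow
  have : Continuous fun t : ℝ => (4 / 3) * (Real.sin (π * m * t) ^ 2 - 1 / 4) := by fun_prop
  exact (this.integrableOn_Icc (a := 0) (b := 1)).mono_set Ioo_subset_Icc_self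

/-- One-particle function. -/
def Uf (m : ℕ) (x : Plane) : ℝ := pf m x.1 * pf m x.2

lemma Uf_contDiff (m : ℕ) : ContDiff ℝ (⊤ : ℕ∞) (Uf m) :=
  ((pf_contDiff m).comp contDiff_fst).mul ((pf_contDiff m).comp contDiff_snd)

lemma Uf_nonneg (m : ℕ) (x : Plane) : 0 ≤ Uf m x := mul_nonneg (pf_nonneg _ _) (pf_nonneg _ _)

lemma Uf_le_one (m : ℕ) (x : Plane) : Uf m x ≤ 1 :=
  mul_le_one₀ (pf_le_one _ _) (pf_nonneg _ _) (pf_le_one _ _)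

/-- The two-dimensional good set. -/
def Gp (m : ℕ) : Set Plane := Gd m ×ˢ Gd m

lemma Gp_closed (m : ℕ) : IsClosed (Gp m) := (Gd_closed m).prod (Gd_closed m)

lemma Gp_compact (m : ℕ) : IsCompact (Gp m) := by
  have : IsCompact (Gd m) := isCompact_Icc.of_isClosed_subset (Gd_closed m) (fun t ht => ht.1)
  exact this.prod this

lemma Gp_subset (m : ℕ) : Gp m ⊆ Q0 := fun _ hx => ⟨Gd_subset m hx.1, Gd_subset m hx.2⟩

lemma Uf_zero (m : ℕ) {x : Plane} (hx : x ∉ Gp m) : Uf m x = 0 := by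
  unfold Uf
  by_cases h1 : x.1 ∈ Gd m
  · have h2 : x.2 ∉ Gd m := fun h2 => hx ⟨h1, h2⟩
    rw [pf_zero m h2, mul_zero]
  · rw [pf_zero m h1, zero_mul]

lemma Uf_deriv (m : ℕ) {K : ℝ} (hK : ∀ x : ℝ, |deriv Real.smoothTransition x| ≤ K)
    (x v : Plane) (h1 : |v.1| ≤ 1) (h2 : |v.2| ≤ 1) :
    ∃ d : ℝ, HasDerivAt (fun t : ℝ => Uf m (x + t • v)) d 0 ∧ |d| ≤ 32 * π * K * m := by
  obtain ⟨d1, hd1, hb1⟩ := pf_deriv m hK x.1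
  obtain ⟨d2, hd2, hb2⟩ := pf_deriv m hK x.2
  have e1 : HasDerivAt (fun t : ℝ => x.1 + t * v.1) v.1 0 := by
    simpa using ((hasDerivAt_id (0:ℝ)).mul_const v.1).const_add x.1
  have e2 : HasDerivAt (fun t : ℝ => x.2 + t * v.2) v.2 0 := by
    simpa using ((hasDerivAt_id (0:ℝ)).mul_const v.2).const_add x.2
  have f1 : HasDerivAt (fun t : ℝ => pf m (x.1 + t * v.1)) (d1 * v.1) 0 :=
    HasDerivAt.comp (h₂ := pf m) (0:ℝ) (by simpa using hd1) e1
  have f2 : HasDerivAt (fun t : ℝ => pf m (x.2 + t * v.2)) (d2 * v.2) 0 :=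
    HasDerivAt.comp (h₂ := pf m) (0:ℝ) (by simpa using hd2) e2
  refine ⟨_, f1.mul f2, ?_⟩
  have g1 : |d1 * v.1| ≤ 16 * π * K * m := by
    rw [abs_mul]
    calc _ ≤ |d1| * 1 := by gcongr
      _ ≤ _ := by linarith
  have g2 : |d2 * v.2| ≤ 16 * π * K * m := by
    rw [abs_mul]
    calc _ ≤ |d2| * 1 := by gcongr
      _ ≤ _ := by linarith
  have q1 : |pf m (x.1 + 0 * v.1)| ≤ 1 := by
    rw [abs_of_nonneg (pf_nonneg _ _)]; exact pf_le_one _ _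
  have q2 : |pf m (x.2 + 0 * v.2)| ≤ 1 := by
    rw [abs_of_nonneg (pf_nonneg _ _)]; exact pf_le_one _ _
  calc _ ≤ |d1 * v.1| * |pf m (x.2 + 0 * v.2)| + |pf m (x.1 + 0 * v.1)| * |d2 * v.2| := by
        rw [← abs_mul, ← abs_mul]; exact abs_add_le _ _
    _ ≤ |d1 * v.1| * 1 + 1 * |d2 * v.2| := by gcongr
    _ ≤ _ := by linarith

lemma Uf_int (m : ℕ) (hm : 1 ≤ m) :
    ENNReal.ofReal (1 / 9) ≤ ∫⁻ x in Q0, ENNReal.ofReal (Uf m x ^ 2) := by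
  have hmeas : Measurable fun t : ℝ => ENNReal.ofReal (pf m t ^ 2) :=
    ((((pf_contDiff m).continuous).pow 2).measurable).ennreal_ofReal
  have h : ∫⁻ x in Q0, ENNReal.ofReal (Uf m x ^ 2) =
      (∫⁻ t in Ioo (0:ℝ) 1, ENNReal.ofReal (pf m t ^ 2)) *
      (∫⁻ t in Ioo (0:ℝ) 1, ENNReal.ofReal (pf m t ^ 2)) := by
    rw [← lintegral_prod_mul hmeas.aemeasurable hmeas.aemeasurable, Measure.prod_restrict]
    apply lintegral_congr
    intro x
    rw [← ENNReal.ofReal_mul (sq_nonneg _)]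
    unfold Uf
    rw [mul_pow]
  rw [h]
  have := pf_int m hm
  calc ENNReal.ofReal (1 / 9) = ENNReal.ofReal (1 / 3) * ENNReal.ofReal (1 / 3) := by
        rw [← ENNReal.ofReal_mul (by norm_num)]; norm_num
    _ ≤ _ := mul_le_mul' this this

/-! ### Pair functions -/

/-- Squared Euclidean norm. -/
def nq (v : Plane) : ℝ := v.1 ^ 2 + v.2 ^ 2

lemma nq_nonneg (v : Plane) : 0 ≤ nq v := by unfold nq; positivity

/-- Logarithmic cutoff, as a function of the squared distance. -/
def fcut (β R q : ℝ) : ℝ :=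
  if q ≤ 0 then 0 else Real.smoothTransition (1 + β / 2 * Real.log (q / R ^ 2))

/-- Square of the inner radius of the cutoff. -/
def rsq (β R : ℝ) : ℝ := R ^ 2 * Real.exp (-(2 / β))

lemma rsq_pos {β R : ℝ} (hR : 0 < R) : 0 < rsq β R := by unfold rsq; positivity

lemma fcut_zero {β R q : ℝ} (hβ : 0 < β) (hR : 0 < R) (hq : q ≤ rsq β R) : fcut β R q = 0 := by
  unfold fcut
  split_ifs with h
  · rfl
  · apply Real.smoothTransition.zero_of_nonpos
    push Not at h
    have h1 : Real.log (q / R ^ 2) ≤ -(2 / β) := by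
      rw [Real.log_le_iff_le_exp (by positivity), div_le_iff₀ (by positivity)]
      unfold rsq at hq
      linarith
    calc 1 + β / 2 * Real.log (q / R ^ 2) ≤ 1 + β / 2 * (-(2 / β)) := by gcongr
      _ = 0 := by field_simp; norm_num

lemma fcut_one {β R q : ℝ} (hβ : 0 < β) (hR : 0 < R) (hq : R ^ 2 ≤ q) : fcut β R q = 1 := by
  have hR2 : 0 < R ^ 2 := by positivity
  unfold fcut
  rw [if_neg (by linarith)]
  apply Real.smoothTransition.one_of_one_le
  have : 0 ≤ Real.log (q / R ^ 2) := Real.log_nonneg ((one_le_div hR2).2 hq)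
  have : 0 ≤ β / 2 * Real.log (q / R ^ 2) := by positivity
  linarith

lemma fcut_nonneg (β R q : ℝ) : 0 ≤ fcut β R q := by
  unfold fcut; split_ifs
  · exact le_rfl
  · exact Real.smoothTransition.nonneg _

lemma fcut_le_one (β R q : ℝ) : fcut β R q ≤ 1 := by
  unfold fcut; split_ifs
  · exact zero_le_one
  · exact Real.smoothTransition.le_one _

lemma fcut_ev_zero {β R q : ℝ} (hβ : 0 < β) (hR : 0 < R) (hq : q < rsq β R) :
    fcut β R =ᶠ[𝓝 q] fun _ => 0 := by
  filter_upwards [Iio_mem_nhds hq] with s hs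
  exact fcut_zero hβ hR (le_of_lt hs)

lemma fcut_ev {β R q : ℝ} (hq : 0 < q) :
    fcut β R =ᶠ[𝓝 q] fun q => Real.smoothTransition (1 + β / 2 * Real.log (q / R ^ 2)) := by
  filter_upwards [Ioi_mem_nhds hq] with s hs
  unfold fcut
  rw [if_neg (not_le.2 hs)]

lemma fcut_contDiff {β R : ℝ} (hβ : 0 < β) (hR : 0 < R) : ContDiff ℝ (⊤ : ℕ∞) (fcut β R) := by
  rw [contDiff_iff_contDiffAt]
  intro q
  by_cases hq : q < rsq β R
  · exact contDiffAt_const.congr_of_eventuallyEq (fcut_ev_zero hβ hR hq)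
  · have hq0 : 0 < q := lt_of_lt_of_le (rsq_pos hR) (not_lt.1 hq)
    refine ContDiffAt.congr_of_eventuallyEq ?_ (fcut_ev hq0)
    refine (Real.smoothTransition.contDiffAt).comp q ?_
    refine contDiffAt_const.add (contDiffAt_const.mul ?_)
    exact (contDiffAt_id.div_const _).log (by simp only [id]; positivity)

lemma fcut_deriv {β R K : ℝ} (hβ : 0 < β) (hR : 0 < R)
    (hK : ∀ x : ℝ, |deriv Real.smoothTransition x| ≤ K) {q : ℝ} (hq : 0 < q) :
    ∃ d, HasDerivAt (fcut β R) d q ∧ |d| ≤ K * β / (2 * q) := by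
  have h1 : HasDerivAt (fun q => 1 + β / 2 * Real.log (q / R ^ 2))
      (β / 2 * ((1 / R ^ 2) / (q / R ^ 2))) q :=
    ((((hasDerivAt_id q).div_const (R ^ 2)).log
      (by simp only [id]; positivity)).const_mul (β / 2)).const_add 1
  refine ⟨_, ((smT_hasDerivAt _).comp q h1).congr_of_eventuallyEq (fcut_ev hq), ?_⟩
  rw [abs_mul]
  have e : β / 2 * ((1 / R ^ 2) / (q / R ^ 2)) = β / (2 * q) := by field_simp
  rw [e, abs_of_pos (by positivity : 0 < β / (2 * q))]
  calc _ ≤ K * (β / (2 * q)) := by gcongr; exact hK _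
    _ = _ := by ring

/-- Local pair factor when the columns differ. -/
def H1 (a : ℝ) (v : Plane) : ℂ :=
  Complex.exp (-Complex.I * ((a * Real.arctan (v.2 / v.1) : ℝ) : ℂ))

/-- Local pair factor when the rows differ. -/
def H2 (a : ℝ) (v : Plane) : ℂ :=
  Complex.exp (-Complex.I * ((a * -Real.arctan (v.1 / v.2) : ℝ) : ℂ))

/-- Local pair factor inside one cell. -/
def H3 (β R : ℝ) (v : Plane) : ℂ := ((fcut β R (nq v) : ℝ) : ℂ)

/-- The (half) pair factor. -/
def Hf (m : ℕ) (a β R : ℝ) (x y : Plane) : ℂ :=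
  if ⌊(m : ℝ) * x.1⌋ ≠ ⌊(m : ℝ) * y.1⌋ then H1 a (x - y)
  else if ⌊(m : ℝ) * x.2⌋ ≠ ⌊(m : ℝ) * y.2⌋ then H2 a (x - y)
  else H3 β R (x - y)

lemma nq_neg (v : Plane) : nq (-v) = nq v := by simp [nq]

lemma Hf_symm (m : ℕ) (a β R : ℝ) (x y : Plane) : Hf m a β R x y = Hf m a β R y x := by
  unfold Hf
  have e : y - x = -(x - y) := by abel
  have h1 : H1 a (y - x) = H1 a (x - y) := by
    rw [e]; simp only [H1, Prod.snd_neg, Prod.fst_neg, neg_div_neg_eq]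
  have h2 : H2 a (y - x) = H2 a (x - y) := by
    rw [e]; simp only [H2, Prod.snd_neg, Prod.fst_neg, neg_div_neg_eq]
  have h3 : H3 β R (y - x) = H3 β R (x - y) := by
    rw [e]; simp only [H3, nq_neg]
  rw [h1, h2, h3]
  simp only [ne_comm]

lemma norm_expI (r : ℝ) : ‖Complex.exp (-Complex.I * (r : ℂ))‖ = 1 := by
  rw [Complex.norm_exp]; simp

lemma Hf_norm_le (m : ℕ) (a β R : ℝ) (x y : Plane) : ‖Hf m a β R x y‖ ≤ 1 := by
  unfold Hf
  split_ifs
  · exact (norm_expI _).le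
  · exact (norm_expI _).le
  · unfold H3
    rw [Complex.norm_real, Real.norm_of_nonneg (fcut_nonneg _ _ _)]
    exact fcut_le_one _ _ _

lemma Hf_norm_one {m : ℕ} {a β R : ℝ} (hβ : 0 < β) (hR : 0 < R) (x y : Plane)
    (h : R ^ 2 ≤ nq (x - y)) : ‖Hf m a β R x y‖ = 1 := by
  unfold Hf
  split_ifs
  · exact norm_expI _
  · exact norm_expI _
  · unfold H3
    rw [fcut_one hβ hR h]; simp

/-- Majorant of the magnetic derivative of the pair factor. -/
def gf (m : ℕ) (β R K : ℝ) (v : Plane) : ℝ :=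
  if rsq β R ≤ nq v ∧ nq v ≤ 2 / (m : ℝ) ^ 2 then 2 * (K + 1) * β / √(nq v) else 0

lemma gf_nonneg {m : ℕ} {β R K : ℝ} (hβ : 0 < β) (hK : 0 ≤ K) (v : Plane) :
    0 ≤ gf m β R K v := by
  unfold gf; split_ifs <;> positivity

lemma mul_bd {a b s : ℝ} (h1 : a ≤ s) (h2 : b ≤ 1) (hb : 0 ≤ b) (hs : 0 ≤ s) : a * b ≤ s := by
  nlinarith

/-- Angular derivative. -/
lemma phase_deriv {θ : ℝ → ℝ} {a p : ℝ} (h : HasDerivAt θ p 0) :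
    ∃ d : ℂ, HasDerivAt (fun t : ℝ => Complex.exp (-Complex.I * ((a * θ t : ℝ) : ℂ))) d 0 ∧
      -Complex.I * d + ((a * p : ℝ) : ℂ) * Complex.exp (-Complex.I * ((a * θ 0 : ℝ) : ℂ)) = 0 := by
  have h1 : HasDerivAt (fun t : ℝ => ((a * θ t : ℝ) : ℂ)) ((a * p : ℝ) : ℂ) 0 :=
    (h.const_mul a).ofReal_comp
  refine ⟨_, (h1.const_mul (-Complex.I)).cexp, ?_⟩
  have hI := Complex.I_mul_I
  linear_combination (((a * p : ℝ) : ℂ) * Complex.exp (-Complex.I * ((a * θ 0 : ℝ) : ℂ))) * hI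

lemma line_deriv (w v : ℝ) : HasDerivAt (fun t : ℝ => w + t * v) v 0 := by
  simpa using ((hasDerivAt_id (0:ℝ)).mul_const v).const_add w

/-- Local structure of the pair factor at good points. -/
lemma Hf_local {m : ℕ} (hm : 1 ≤ m) {a β R K : ℝ} (ha : 0 ≤ a) (haβ : a ≤ β) (hβ : 0 < β)
    (hR : 0 < R) (hK : ∀ x : ℝ, |deriv Real.smoothTransition x| ≤ K)
    {x y : Plane} (hx : x ∈ Gp m) (hy : y ∈ Gp m) :
    ∃ G : Plane → ℂ,
      (fun p : Plane × Plane => Hf m a β R p.1 p.2) =ᶠ[𝓝 (x, y)] (fun p => G (p.1 - p.2)) ∧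
      ContDiffAt ℝ (⊤ : ℕ∞) G (x - y) ∧
      ∀ v : Plane, |v.1| ≤ 1 → |v.2| ≤ 1 → ∃ d : ℂ,
        HasDerivAt (fun t : ℝ => G (x - y + t • v)) d 0 ∧
        ‖-Complex.I * d + ((a * ((perpInv (x - y)).1 * v.1 + (perpInv (x - y)).2 * v.2) : ℝ) : ℂ)
          * G (x - y)‖ ≤ gf m β R K (x - y) := by
  have hK0 : 0 ≤ K := (abs_nonneg _).trans (hK 0)
  have ex1 : ∀ᶠ p : Plane × Plane in 𝓝 (x, y), ⌊(m : ℝ) * p.1.1⌋ = ⌊(m : ℝ) * x.1⌋ :=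
    (Continuous.tendsto (f := fun p : Plane × Plane => p.1.1) (by fun_prop) (x, y)).eventually
      (floor_ev m hx.1)
  have ex2 : ∀ᶠ p : Plane × Plane in 𝓝 (x, y), ⌊(m : ℝ) * p.1.2⌋ = ⌊(m : ℝ) * x.2⌋ :=
    (Continuous.tendsto (f := fun p : Plane × Plane => p.1.2) (by fun_prop) (x, y)).eventually
      (floor_ev m hx.2)
  have ey1 : ∀ᶠ p : Plane × Plane in 𝓝 (x, y), ⌊(m : ℝ) * p.2.1⌋ = ⌊(m : ℝ) * y.1⌋ :=
    (Continuous.tendsto (f := fun p : Plane × Plane => p.2.1) (by fun_prop) (x, y)).eventually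
      (floor_ev m hy.1)
  have ey2 : ∀ᶠ p : Plane × Plane in 𝓝 (x, y), ⌊(m : ℝ) * p.2.2⌋ = ⌊(m : ℝ) * y.2⌋ :=
    (Continuous.tendsto (f := fun p : Plane × Plane => p.2.2) (by fun_prop) (x, y)).eventually
      (floor_ev m hy.2)
  by_cases h1 : ⌊(m : ℝ) * x.1⌋ ≠ ⌊(m : ℝ) * y.1⌋
  · -- columns differ
    have hv : (x - y).1 ≠ 0 := by
      intro h
      apply h1
      rw [Prod.fst_sub, sub_eq_zero] at h
      rw [h]
    refine ⟨H1 a, ?_, ?_, ?_⟩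
    · filter_upwards [ex1, ey1] with p hp1 hp2
      unfold Hf
      rw [hp1, hp2, if_pos h1]
    · unfold H1
      refine ContDiffAt.cexp (contDiffAt_const.mul ?_)
      refine (Complex.ofRealCLM.contDiff.contDiffAt).comp _ (contDiffAt_const.mul ?_)
      exact (contDiffAt_snd.div contDiffAt_fst hv).arctan
    · intro v _ _
      generalize x - y = w at hv ⊢
      have hd : HasDerivAt (fun t : ℝ => Real.arctan ((w.2 + t * v.2) / (w.1 + t * v.1)))
          ((perpInv w).1 * v.1 + (perpInv w).2 * v.2) 0 := by
        have := ((line_deriv w.2 v.2).div (line_deriv w.1 v.1) (by simpa using hv)).arctan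
        refine HasDerivAt.congr_deriv this ?_
        have : w.1 ^ 2 + w.2 ^ 2 ≠ 0 := by positivity
        have : w.2 ^ 2 + w.1 ^ 2 ≠ 0 := by positivity
        simp only [perpInv, Pi.div_apply, zero_mul, add_zero]
        field_simp
        ring
      obtain ⟨d, hd1, hd2⟩ := phase_deriv (a := a) hd
      refine ⟨d, hd1, ?_⟩
      have e : H1 a w = Complex.exp (-Complex.I *
        ((a * Real.arctan ((w.2 + 0 * v.2) / (w.1 + 0 * v.1)) : ℝ) : ℂ)) := by
        simp [H1]
      rw [e, hd2, norm_zero]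
      exact gf_nonneg hβ hK0 _
  by_cases h2 : ⌊(m : ℝ) * x.2⌋ ≠ ⌊(m : ℝ) * y.2⌋
  · -- rows differ
    have hv : (x - y).2 ≠ 0 := by
      intro h
      apply h2
      rw [Prod.snd_sub, sub_eq_zero] at h
      rw [h]
    refine ⟨H2 a, ?_, ?_, ?_⟩
    · filter_upwards [ex1, ey1, ex2, ey2] with p hp1 hp2 hp3 hp4
      unfold Hf
      rw [hp1, hp2, hp3, hp4, if_neg h1, if_pos h2]
    · unfold H2
      refine ContDiffAt.cexp (contDiffAt_const.mul ?_)
      refine (Complex.ofRealCLM.contDiff.contDiffAt).comp _ (contDiffAt_const.mul ?_)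
      exact (contDiffAt_fst.div contDiffAt_snd hv).arctan.neg
    · intro v _ _
      generalize x - y = w at hv ⊢
      have hd : HasDerivAt (fun t : ℝ => -Real.arctan ((w.1 + t * v.1) / (w.2 + t * v.2)))
          ((perpInv w).1 * v.1 + (perpInv w).2 * v.2) 0 := by
        have := ((line_deriv w.1 v.1).div (line_deriv w.2 v.2) (by simpa using hv)).arctan.neg
        refine HasDerivAt.congr_deriv this ?_
        have : w.1 ^ 2 + w.2 ^ 2 ≠ 0 := by positivity
        have : w.2 ^ 2 + w.1 ^ 2 ≠ 0 := by positivity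
        simp only [perpInv, Pi.div_apply, zero_mul, add_zero]
        field_simp
        ring
      obtain ⟨d, hd1, hd2⟩ := phase_deriv (a := a) hd
      refine ⟨d, hd1, ?_⟩
      have e : H2 a w = Complex.exp (-Complex.I *
        ((a * -Real.arctan ((w.1 + 0 * v.1) / (w.2 + 0 * v.2)) : ℝ) : ℂ)) := by
        simp [H2]
      rw [e, hd2, norm_zero]
      exact gf_nonneg hβ hK0 _
  · -- same cell
    have hnq : ContDiff ℝ (⊤ : ℕ∞) nq := by
      unfold nq; fun_prop
    refine ⟨H3 β R, ?_, ?_, ?_⟩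
    · filter_upwards [ex1, ey1, ex2, ey2] with p hp1 hp2 hp3 hp4
      unfold Hf
      rw [hp1, hp2, hp3, hp4, if_neg h1, if_neg h2]
    · exact (Complex.ofRealCLM.contDiff.comp ((fcut_contDiff hβ hR).comp hnq)).contDiffAt
    · intro v hv1 hv2
      have hb : nq (x - y) ≤ 2 / (m : ℝ) ^ 2 := by
        have hm0 : (0:ℝ) < m := by exact_mod_cast hm
        push Not at h1 h2
        have e1 := Int.abs_sub_lt_one_of_floor_eq_floor h1
        have e2 := Int.abs_sub_lt_one_of_floor_eq_floor h2
        have e1' : ((m:ℝ) * x.1 - m * y.1) ^ 2 ≤ 1 := by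
          rw [sq_le_one_iff_abs_le_one]; exact e1.le
        have e2' : ((m:ℝ) * x.2 - m * y.2) ^ 2 ≤ 1 := by
          rw [sq_le_one_iff_abs_le_one]; exact e2.le
        rw [le_div_iff₀ (by positivity)]
        simp only [nq, Prod.fst_sub, Prod.snd_sub]
        nlinarith
      generalize x - y = w at hb ⊢
      have hn : HasDerivAt (fun t : ℝ => nq (w + t • v)) (2 * (w.1 * v.1 + w.2 * v.2)) 0 := by
        have := ((line_deriv w.1 v.1).pow 2).add ((line_deriv w.2 v.2).pow 2)
        refine HasDerivAt.congr_deriv this ?_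
        norm_num; ring
      by_cases hq : nq w < rsq β R
      · -- inside the hole
        refine ⟨0, ?_, ?_⟩
        · refine (hasDerivAt_const (0:ℝ) (0:ℂ)).congr_of_eventuallyEq ?_
          have hc : ContinuousAt (fun t : ℝ => nq (w + t • v)) 0 := hn.continuousAt
          have : ∀ᶠ t : ℝ in 𝓝 0, nq (w + t • v) < rsq β R :=
            hc.eventually (Iio_mem_nhds (by simpa using hq))
          filter_upwards [this] with t ht
          unfold H3
          rw [fcut_zero hβ hR ht.le]; simp
        · unfold H3
          rw [fcut_zero hβ hR hq.le]
          simpa using gf_nonneg hβ hK0 w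
      · push Not at hq
        have hq0 : 0 < nq w := lt_of_lt_of_le (rsq_pos hR) hq
        obtain ⟨d, hd, hdb⟩ := fcut_deriv hβ hR hK hq0
        have hcomp : HasDerivAt (fun t : ℝ => fcut β R (nq (w + t • v)))
            (d * (2 * (w.1 * v.1 + w.2 * v.2))) 0 :=
          HasDerivAt.comp (h₂ := fcut β R) (0:ℝ) (by simpa using hd) hn
        refine ⟨_, hcomp.ofReal_comp, ?_⟩
        set s := √(nq w) with hs
        have hs0 : 0 < s := Real.sqrt_pos.2 hq0
        have hs2 : s ^ 2 = nq w := Real.sq_sqrt hq0.le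
        have hw1 : |w.1| ≤ s := by
          apply Real.abs_le_sqrt; unfold nq; nlinarith [sq_nonneg w.2]
        have hw2 : |w.2| ≤ s := by
          apply Real.abs_le_sqrt; unfold nq; nlinarith [sq_nonneg w.1]
        have hdot : |2 * (w.1 * v.1 + w.2 * v.2)| ≤ 4 * s := by
          have t1 : |w.1 * v.1| ≤ s := by
            rw [abs_mul]; exact mul_bd hw1 hv1 (abs_nonneg _) hs0.le
          have t2 : |w.2 * v.2| ≤ s := by
            rw [abs_mul]; exact mul_bd hw2 hv2 (abs_nonneg _) hs0.le
          rw [abs_mul, abs_two]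
          linarith [abs_add_le (w.1 * v.1) (w.2 * v.2)]
        have hperp : |(perpInv w).1 * v.1 + (perpInv w).2 * v.2| ≤ 2 / s := by
          have e : (perpInv w).1 * v.1 + (perpInv w).2 * v.2 =
              (-w.2 * v.1 + w.1 * v.2) / nq w := by
            simp only [perpInv, nq]; ring
          rw [e, abs_div, abs_of_pos hq0, div_le_div_iff₀ hq0 hs0]
          have t1 : |-w.2 * v.1| ≤ s := by
            rw [abs_mul, abs_neg]; exact mul_bd hw2 hv1 (abs_nonneg _) hs0.le
          have t2 : |w.1 * v.2| ≤ s := by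
            rw [abs_mul]; exact mul_bd hw1 hv2 (abs_nonneg _) hs0.le
          have := abs_add_le (-w.2 * v.1) (w.1 * v.2)
          rw [← hs2]
          nlinarith
        have hfin : gf m β R K w = 2 * (K + 1) * β / s := by
          unfold gf
          rw [if_pos ⟨hq, hb⟩]
        rw [hfin]
        have n1 : ‖-Complex.I * ((d * (2 * (w.1 * v.1 + w.2 * v.2)) : ℝ) : ℂ)‖ ≤ 2 * K * β / s := by
          rw [norm_mul, norm_neg, Complex.norm_I, one_mul, Complex.norm_real, Real.norm_eq_abs,
            abs_mul]
          calc _ ≤ K * β / (2 * nq w) * (4 * s) := by gcongr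
            _ = _ := by rw [← hs2]; field_simp; norm_num
        have n2 : ‖((a * ((perpInv w).1 * v.1 + (perpInv w).2 * v.2) : ℝ) : ℂ) * H3 β R w‖
            ≤ 2 * β / s := by
          unfold H3
          rw [norm_mul, Complex.norm_real, Complex.norm_real, Real.norm_eq_abs, abs_mul,
            abs_of_nonneg ha, Real.norm_of_nonneg (fcut_nonneg _ _ _)]
          calc _ ≤ β * (2 / s) * 1 := by
                gcongr
                · exact fcut_nonneg _ _ _
                · exact fcut_le_one _ _ _
            _ = _ := by ring
        calc _ ≤ 2 * K * β / s + 2 * β / s := (norm_add_le _ _).trans (add_le_add n1 n2)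
          _ = _ := by ring

lemma meas_Hf (m : ℕ) (a β R : ℝ) (hβ : 0 < β) (hR : 0 < R) :
    Measurable fun p : Plane × Plane => Hf m a β R p.1 p.2 := by
  have hnq : Measurable nq := by unfold nq; fun_prop
  have hf : Measurable (fcut β R) := (fcut_contDiff hβ hR).continuous.measurable
  have hfl1 : Measurable fun p : Plane × Plane => ⌊(m : ℝ) * p.1.1⌋ :=
    Int.measurable_floor.comp (by fun_prop)
  have hfl2 : Measurable fun p : Plane × Plane => ⌊(m : ℝ) * p.2.1⌋ :=
    Int.measurable_floor.comp (by fun_prop)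
  have hfl3 : Measurable fun p : Plane × Plane => ⌊(m : ℝ) * p.1.2⌋ :=
    Int.measurable_floor.comp (by fun_prop)
  have hfl4 : Measurable fun p : Plane × Plane => ⌊(m : ℝ) * p.2.2⌋ :=
    Int.measurable_floor.comp (by fun_prop)
  have m1 : Measurable (H1 a) := by
    unfold H1
    refine Complex.measurable_exp.comp (Measurable.const_mul ?_ _)
    refine Complex.measurable_ofReal.comp (Measurable.const_mul ?_ _)
    exact Real.measurable_arctan.comp (by fun_prop)
  have m2 : Measurable (H2 a) := by
    unfold H2
    refine Complex.measurable_exp.comp (Measurable.const_mul ?_ _)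
    refine Complex.measurable_ofReal.comp (Measurable.const_mul ?_ _)
    exact (Real.measurable_arctan.comp (by fun_prop)).neg
  have m3 : Measurable (H3 β R) := Complex.measurable_ofReal.comp (hf.comp hnq)
  have hs : Measurable fun p : Plane × Plane => p.1 - p.2 := by fun_prop
  unfold Hf
  refine Measurable.ite (measurableSet_eq_fun hfl1 hfl2).compl (m1.comp hs) ?_
  exact Measurable.ite (measurableSet_eq_fun hfl3 hfl4).compl (m2.comp hs) (m3.comp hs)

/-! ### The many-body trial function -/

/-- The Jastrow-type product over the particles in `S`. -/
def Phi (m : ℕ) (a β R : ℝ) {N : ℕ} (S : Finset (Fin N)) (x : Config N) : ℂ :=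
  (∏ k ∈ S, (Uf m (x k) : ℂ)) * ∏ p ∈ S.offDiag, Hf m a β R (x p.1) (x p.2)

lemma Phi_insert (m : ℕ) (a β R : ℝ) {N : ℕ} {S : Finset (Fin N)} {j : Fin N} (hj : j ∉ S)
    (x : Config N) :
    Phi m a β R (insert j S) x =
      ((Uf m (x j) : ℂ) * ∏ k ∈ S, Hf m a β R (x j) (x k) ^ 2) * Phi m a β R S x := by
  unfold Phi
  have d1 : Disjoint S.offDiag ({j} ×ˢ S) := by
    rw [Finset.disjoint_left]
    rintro ⟨p, q⟩ hp hq
    simp only [Finset.mem_offDiag, Finset.mem_product, Finset.mem_singleton] at hp hq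
    exact hj (hq.1 ▸ hp.1)
  have d2 : Disjoint (S.offDiag ∪ {j} ×ˢ S) (S ×ˢ {j}) := by
    rw [Finset.disjoint_left]
    rintro ⟨p, q⟩ hp hq
    simp only [Finset.mem_union, Finset.mem_offDiag, Finset.mem_product,
      Finset.mem_singleton] at hp hq
    rcases hp with hp | hp
    · exact hj (hq.2 ▸ hp.2.1)
    · exact hj (hp.1 ▸ hq.1)
  rw [Finset.prod_insert hj, Finset.offDiag_insert hj, Finset.prod_union d2, Finset.prod_union d1,
    Finset.prod_product, Finset.prod_product_right, Finset.prod_singleton, Finset.prod_singleton]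
  have e : ∏ k ∈ S, Hf m a β R (x k) (x j) = ∏ k ∈ S, Hf m a β R (x j) (x k) :=
    Finset.prod_congr rfl fun k _ => Hf_symm _ _ _ _ _ _
  simp only [e, Finset.prod_pow]
  ring

lemma Phi_update (m : ℕ) (a β R : ℝ) {N : ℕ} {S : Finset (Fin N)} {j : Fin N} (hj : j ∉ S)
    (x : Config N) (y : Plane) :
    Phi m a β R S (Function.update x j y) = Phi m a β R S x := by
  unfold Phi
  congr 1
  · refine Finset.prod_congr rfl fun k hk => ?_
    have h1 : k ≠ j := fun h => hj (h ▸ hk)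
    rw [Function.update_of_ne h1]
  · refine Finset.prod_congr rfl fun p hp => ?_
    rw [Finset.mem_offDiag] at hp
    have h1 : p.1 ≠ j := fun h => hj (h ▸ hp.1)
    have h2 : p.2 ≠ j := fun h => hj (h ▸ hp.2.1)
    rw [Function.update_of_ne h1, Function.update_of_ne h2]

lemma Phi_zero (m : ℕ) (a β R : ℝ) {N : ℕ} {x : Config N}
    (hx : x ∉ Set.univ.pi fun _ : Fin N => Gp m) : Phi m a β R Finset.univ x = 0 := by
  rw [Set.mem_univ_pi] at hx
  push Not at hx
  obtain ⟨k, hk⟩ := hx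
  unfold Phi
  rw [Finset.prod_eq_zero (Finset.mem_univ k), zero_mul]
  rw [Uf_zero m hk]; simp

lemma cubeG_closed (m N : ℕ) : IsClosed (Set.univ.pi fun _ : Fin N => Gp m) :=
  isClosed_set_pi fun _ _ => Gp_closed m

lemma Phi_ev_zero (m : ℕ) (a β R : ℝ) {N : ℕ} {x : Config N}
    (hx : x ∉ Set.univ.pi fun _ : Fin N => Gp m) :
    Phi m a β R (Finset.univ : Finset (Fin N)) =ᶠ[𝓝 x] fun _ => 0 := by
  filter_upwards [(cubeG_closed m N).isOpen_compl.mem_nhds hx] with y hy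
  exact Phi_zero m a β R hy

lemma Phi_tsupport (m : ℕ) (a β R : ℝ) (N : ℕ) :
    tsupport (Phi m a β R (Finset.univ : Finset (Fin N))) ⊆ Set.univ.pi fun _ : Fin N => Gp m := by
  apply closure_minimal _ (cubeG_closed m N)
  intro x hx
  by_contra h
  exact hx (Phi_zero m a β R h)

lemma Phi_compact (m : ℕ) (a β R : ℝ) (N : ℕ) :
    IsCompact (tsupport (Phi m a β R (Finset.univ : Finset (Fin N)))) :=
  (isCompact_univ_pi fun _ => Gp_compact m).of_isClosed_subset (isClosed_tsupport _)
    (Phi_tsupport m a β R N)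

lemma Phi_contDiff {m : ℕ} (hm : 1 ≤ m) {a β R K : ℝ} (ha : 0 ≤ a) (haβ : a ≤ β) (hβ : 0 < β)
    (hR : 0 < R) (hK : ∀ x : ℝ, |deriv Real.smoothTransition x| ≤ K) (N : ℕ) :
    ContDiff ℝ (⊤ : ℕ∞) (Phi m a β R (Finset.univ : Finset (Fin N))) := by
  rw [contDiff_iff_contDiffAt]
  intro x
  by_cases hx : x ∈ Set.univ.pi fun _ : Fin N => Gp m
  · rw [Set.mem_univ_pi] at hx
    unfold Phi
    refine ContDiffAt.mul (contDiffAt_prod fun k _ => ?_) (contDiffAt_prod fun p _ => ?_)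
    · have h1 : ContDiff ℝ (⊤ : ℕ∞) fun y : Config N => Uf m (y k) :=
        (Uf_contDiff m).comp (contDiff_apply ℝ Plane k)
      exact (Complex.ofRealCLM.contDiff.comp h1).contDiffAt
    · obtain ⟨G, hG1, hG2, -⟩ := Hf_local hm ha haβ hβ hR hK (hx p.1) (hx p.2)
      have hc : ContinuousAt (fun y : Config N => (y p.1, y p.2)) x := by fun_prop
      have he := hc.eventually hG1
      refine ContDiffAt.congr_of_eventuallyEq (f := fun y : Config N => G (y p.1 - y p.2)) ?_ he
      refine ContDiffAt.comp (g := G) x hG2 ?_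
      exact ((contDiff_apply ℝ Plane p.1).sub (contDiff_apply ℝ Plane p.2)).contDiffAt
  · exact contDiffAt_const.congr_of_eventuallyEq (Phi_ev_zero m a β R hx)

lemma Phi_symm (m : ℕ) (a β R : ℝ) (N : ℕ) (σ : Equiv.Perm (Fin N)) (x : Config N) :
    Phi m a β R Finset.univ (x ∘ σ) = Phi m a β R Finset.univ x := by
  unfold Phi
  congr 1
  · exact Equiv.prod_comp σ fun k => (Uf m (x k) : ℂ)
  · refine Finset.prod_equiv (σ.prodCongr σ) ?_ ?_
    · intro p
      simp [Finset.mem_offDiag]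
    · intro p _
      rfl

lemma Phi_diag {m : ℕ} {a β R : ℝ} (hβ : 0 < β) (hR : 0 < R) {N : ℕ} {x : Config N}
    (hx : x ∈ diagSet N) :
    ∀ᶠ y in 𝓝 x, Phi m a β R (Finset.univ : Finset (Fin N)) y = 0 := by
  by_cases hg : x ∈ Set.univ.pi fun _ : Fin N => Gp m
  · rw [Set.mem_univ_pi] at hg
    obtain ⟨j, k, hjk, he⟩ := hx
    have c : ∀ i : Fin N, ContinuousAt (fun y : Config N => y i) x := fun i => continuousAt_apply i x
    have e1 := ((continuousAt_fst.comp (c j)).eventually (floor_ev m (hg j).1))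
    have e2 := ((continuousAt_snd.comp (c j)).eventually (floor_ev m (hg j).2))
    have e3 := ((continuousAt_fst.comp (c k)).eventually (floor_ev m (hg k).1))
    have e4 := ((continuousAt_snd.comp (c k)).eventually (floor_ev m (hg k).2))
    have hq : Continuous fun y : Config N => nq (y j - y k) := by
      unfold nq; fun_prop
    have e5 : ∀ᶠ y in 𝓝 x, nq (y j - y k) < rsq β R := by
      refine hq.continuousAt.eventually (Iio_mem_nhds ?_)
      show nq (x j - x k) < rsq β R
      rw [he]
      simpa [nq] using rsq_pos hR
    filter_upwards [e1, e2, e3, e4, e5] with y h1 h2 h3 h4 h5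
    simp only [Function.comp] at h1 h2 h3 h4
    unfold Phi
    rw [Finset.prod_eq_zero (s := Finset.univ.offDiag) (i := (j, k)) (by simpa using hjk), mul_zero]
    unfold Hf
    rw [h1, h2, h3, h4, he]
    simp only [ne_eq, not_true_eq_false, if_false]
    unfold H3
    rw [fcut_zero hβ hR h5.le]; simp
  · exact Phi_ev_zero m a β R hg

lemma Phi_admissible {m : ℕ} (hm : 1 ≤ m) {a β R K : ℝ} (ha : 0 ≤ a) (haβ : a ≤ β) (hβ : 0 < β)
    (hR : 0 < R) (hK : ∀ x : ℝ, |deriv Real.smoothTransition x| ≤ K) (N : ℕ) :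
    Admissible N (Phi m a β R (Finset.univ : Finset (Fin N))) where
  smooth := Phi_contDiff hm ha haβ hβ hR hK N
  symm := Phi_symm m a β R N
  vanishes := by
    refine ⟨interior {y | Phi m a β R (Finset.univ : Finset (Fin N)) y = 0}, isOpen_interior,
      ?_, fun y hy => ?_⟩
    · intro x hx
      rw [mem_interior_iff_mem_nhds]
      exact Phi_diag hβ hR hx
    · have h := interior_subset hy
      exact h

/-- Leibniz rule with bounded factors. -/
lemma leibniz_bound {ι : Type*} [DecidableEq ι] (S : Finset ι) (u : ℝ → ℂ) (u' : ℂ)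
    (h : ι → ℝ → ℂ) (h' : ι → ℂ) (p : ι → ℝ) (a M : ℝ) (g : ι → ℝ)
    (hu : HasDerivAt u u' 0) (hh : ∀ k ∈ S, HasDerivAt (h k) (h' k) 0)
    (hu1 : ‖u 0‖ ≤ 1) (hh1 : ∀ k ∈ S, ‖h k 0‖ ≤ 1) (huM : ‖u'‖ ≤ M)
    (hg : ∀ k ∈ S, ‖-Complex.I * h' k + ((a * p k : ℝ) : ℂ) * h k 0‖ ≤ g k) :
    ∃ d : ℂ, HasDerivAt (fun t => u t * ∏ k ∈ S, h k t ^ 2) d 0 ∧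
      ‖-Complex.I * d + ((2 * a * ∑ k ∈ S, p k : ℝ) : ℂ) * (u 0 * ∏ k ∈ S, h k 0 ^ 2)‖
        ≤ M + 2 * ∑ k ∈ S, g k := by
  induction S using Finset.induction_on with
  | empty =>
    refine ⟨u', by simpa using hu, ?_⟩
    simpa using huM
  | insert i S hi ih =>
    obtain ⟨d, hd, hdb⟩ := ih (fun k hk => hh k (Finset.mem_insert_of_mem hk))
      (fun k hk => hh1 k (Finset.mem_insert_of_mem hk))
      (fun k hk => hg k (Finset.mem_insert_of_mem hk))
    have hi' := hh i (Finset.mem_insert_self i S)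
    have hi1 := hh1 i (Finset.mem_insert_self i S)
    have hig := hg i (Finset.mem_insert_self i S)
    have hmul := (hi'.pow 2).mul hd
    have hfun : (fun t => u t * ∏ k ∈ insert i S, h k t ^ 2) =
        fun t => (h i t) ^ 2 * (u t * ∏ k ∈ S, h k t ^ 2) := by
      funext t
      rw [Finset.prod_insert hi]; ring
    have hP1 : ‖u 0 * ∏ k ∈ S, h k 0 ^ 2‖ ≤ 1 := by
      rw [norm_mul, norm_prod]
      refine mul_le_one₀ hu1 (Finset.prod_nonneg fun _ _ => norm_nonneg _) ?_
      refine Finset.prod_le_one (fun _ _ => norm_nonneg _) fun k hk => ?_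
      rw [norm_pow]
      exact pow_le_one₀ (norm_nonneg _) (hh1 k (Finset.mem_insert_of_mem hk))
    refine ⟨_, by rw [hfun]; exact hmul, ?_⟩
    rw [Finset.prod_insert hi, Finset.sum_insert hi, Finset.sum_insert hi]
    set P := u 0 * ∏ k ∈ S, h k 0 ^ 2 with hP
    have e : -Complex.I * (((2 : ℕ) : ℂ) * h i 0 ^ (2 - 1) * h' i * P + (h i ^ 2) 0 * d) +
        ((2 * a * (p i + ∑ k ∈ S, p k) : ℝ) : ℂ) * (u 0 * (h i 0 ^ 2 * ∏ k ∈ S, h k 0 ^ 2)) =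
        h i 0 ^ 2 * (-Complex.I * d + ((2 * a * ∑ k ∈ S, p k : ℝ) : ℂ) * P) +
        2 * h i 0 * P * (-Complex.I * h' i + ((a * p i : ℝ) : ℂ) * h i 0) := by
      rw [hP]
      simp only [Pi.pow_apply]
      push_cast
      ring
    rw [e]
    have hg0 : 0 ≤ g i := (norm_nonneg _).trans hig
    have b1 : ‖h i 0 ^ 2 * (-Complex.I * d + ((2 * a * ∑ k ∈ S, p k : ℝ) : ℂ) * P)‖ ≤
        M + 2 * ∑ k ∈ S, g k := by
      rw [norm_mul, norm_pow]
      calc _ ≤ 1 * ‖-Complex.I * d + ((2 * a * ∑ k ∈ S, p k : ℝ) : ℂ) * P‖ := by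
            gcongr
            exact pow_le_one₀ (norm_nonneg _) hi1
        _ ≤ _ := by rw [one_mul]; exact hdb
    have b2 : ‖2 * h i 0 * P * (-Complex.I * h' i + ((a * p i : ℝ) : ℂ) * h i 0)‖ ≤ 2 * g i := by
      rw [norm_mul, norm_mul, norm_mul, Complex.norm_ofNat]
      calc _ ≤ 2 * 1 * 1 * g i := by gcongr
        _ = _ := by ring
    calc _ ≤ _ := norm_add_le _ _
      _ ≤ _ := by linarith

lemma DPhi_le {m : ℕ} (hm : 1 ≤ m) {a β R K : ℝ} (ha : 0 ≤ a) (haβ : a ≤ β) (hβ : 0 < β)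
    (hR : 0 < R) (hK : ∀ x : ℝ, |deriv Real.smoothTransition x| ≤ K) {N : ℕ} (j : Fin N)
    (x : Config N) (v : Plane) (hv1 : |v.1| ≤ 1) (hv2 : |v.2| ≤ 1) :
    ‖-Complex.I * pder N j v (Phi m a β R Finset.univ) x +
      Complex.ofReal (2 * a * ((abPot N j x).1 * v.1 + (abPot N j x).2 * v.2)) *
        Phi m a β R Finset.univ x‖ ≤
    ‖Phi m a β R (Finset.univ.erase j) x‖ *
      (32 * π * K * m + 2 * ∑ k ∈ Finset.univ.erase j, gf m β R K (x j - x k)) := by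
  have hK0 : 0 ≤ K := (abs_nonneg _).trans (hK 0)
  have hpi := Real.pi_pos
  by_cases hx : x ∈ Set.univ.pi fun _ : Fin N => Gp m
  · rw [Set.mem_univ_pi] at hx
    obtain ⟨du, hdu, hdub⟩ := Uf_deriv m hK (x j) v hv1 hv2
    have hdat : ∀ k : Fin N, ∃ d : ℂ,
        HasDerivAt (fun t : ℝ => Hf m a β R (x j + t • v) (x k)) d 0 ∧
        ‖-Complex.I * d + ((a * ((perpInv (x j - x k)).1 * v.1 +
          (perpInv (x j - x k)).2 * v.2) : ℝ) : ℂ) * Hf m a β R (x j) (x k)‖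
          ≤ gf m β R K (x j - x k) := by
      intro k
      obtain ⟨G, hG1, -, hG3⟩ := Hf_local hm ha haβ hβ hR hK (hx j) (hx k)
      obtain ⟨d, hd1, hd2⟩ := hG3 v hv1 hv2
      refine ⟨d, ?_, ?_⟩
      · refine hd1.congr_of_eventuallyEq ?_
        have hc : Filter.Tendsto (fun t : ℝ => (x j + t • v, x k)) (𝓝 0) (𝓝 (x j, x k)) := by
          have : Continuous (fun t : ℝ => (x j + t • v, x k)) := by fun_prop
          simpa using this.tendsto 0
        filter_upwards [hc.eventually hG1] with t ht
        rw [ht]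
        congr 1
        abel
      · have := hG1.eq_of_nhds
        simp only at this
        rw [this]
        exact hd2
    choose h' hh' hhb using hdat
    have hu1 : ‖((Uf m (x j + (0:ℝ) • v) : ℝ) : ℂ)‖ ≤ 1 := by
      rw [Complex.norm_real, Real.norm_of_nonneg (Uf_nonneg _ _)]
      exact Uf_le_one _ _
    obtain ⟨d, hd, hdb⟩ := leibniz_bound (Finset.univ.erase j)
      (fun t : ℝ => ((Uf m (x j + t • v) : ℝ) : ℂ)) (du : ℂ)
      (fun k t => Hf m a β R (x j + t • v) (x k)) h'
      (fun k => (perpInv (x j - x k)).1 * v.1 + (perpInv (x j - x k)).2 * v.2) a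
      (32 * π * K * m) (fun k => gf m β R K (x j - x k)) hdu.ofReal_comp (fun k _ => hh' k)
      hu1 (fun k _ => Hf_norm_le _ _ _ _ _ _) (by rw [Complex.norm_real]; exact hdub)
      (fun k _ => by simpa using hhb k)
    have hins : insert j (Finset.univ.erase j) = (Finset.univ : Finset (Fin N)) :=
      Finset.insert_erase (Finset.mem_univ j)
    have hnm : j ∉ (Finset.univ : Finset (Fin N)).erase j := Finset.notMem_erase _ _
    have hval : Phi m a β R Finset.univ x = (((Uf m (x j) : ℝ) : ℂ) *
        ∏ k ∈ Finset.univ.erase j, Hf m a β R (x j) (x k) ^ 2) *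
        Phi m a β R (Finset.univ.erase j) x := by
      rw [← Phi_insert m a β R hnm, hins]
    have hline : (fun t : ℝ => Phi m a β R Finset.univ (x + t • (Pi.single j v : Config N))) =
        fun t : ℝ => (((Uf m (x j + t • v) : ℝ) : ℂ) *
          ∏ k ∈ Finset.univ.erase j, Hf m a β R (x j + t • v) (x k) ^ 2) *
          Phi m a β R (Finset.univ.erase j) x := by
      funext t
      have e : x + t • (Pi.single j v : Config N) = Function.update x j (x j + t • v) := by
        ext1 k
        by_cases hk : k = j
        · subst hk; simp
        · simp [hk]
      rw [e, ← hins, Phi_insert m a β R hnm, Phi_update m a β R hnm, Function.update_self, hins]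
      congr 2
      refine Finset.prod_congr rfl fun k hk => ?_
      rw [Function.update_of_ne (Finset.ne_of_mem_erase hk)]
    have hpd : pder N j v (Phi m a β R Finset.univ) x =
        d * Phi m a β R (Finset.univ.erase j) x := by
      have hdiff : HasFDerivAt (Phi m a β R (Finset.univ : Finset (Fin N)))
          (fderiv ℝ (Phi m a β R (Finset.univ : Finset (Fin N))) x) x :=
        ((Phi_contDiff hm ha haβ hβ hR hK N).differentiable (by simp) x).hasFDerivAt
      have hl : HasDerivAt (fun t : ℝ => x + t • (Pi.single j v : Config N)) (Pi.single j v) 0 := by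
        simpa using ((hasDerivAt_id (0:ℝ)).smul_const (Pi.single j v : Config N)).const_add x
      have h1 : HasDerivAt (fun t : ℝ => Phi m a β R Finset.univ (x + t • (Pi.single j v : Config N)))
          (fderiv ℝ (Phi m a β R (Finset.univ : Finset (Fin N))) x (Pi.single j v)) 0 :=
        HasFDerivAt.comp_hasDerivAt (l := Phi m a β R (Finset.univ : Finset (Fin N))) (0:ℝ) (by simpa using hdiff) hl
      rw [hline] at h1
      exact h1.unique (hd.mul_const _)
    have hpot : (abPot N j x).1 * v.1 + (abPot N j x).2 * v.2 =
        ∑ k ∈ Finset.univ.erase j,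
          ((perpInv (x j - x k)).1 * v.1 + (perpInv (x j - x k)).2 * v.2) := by
      unfold abPot
      rw [Prod.fst_sum, Prod.snd_sum, Finset.sum_mul, Finset.sum_mul, Finset.sum_add_distrib]
    simp only [zero_smul, add_zero] at hdb
    rw [hpd, hval, hpot]
    have e : -Complex.I * (d * Phi m a β R (Finset.univ.erase j) x) +
        Complex.ofReal (2 * a * ∑ k ∈ Finset.univ.erase j,
          ((perpInv (x j - x k)).1 * v.1 + (perpInv (x j - x k)).2 * v.2)) *
        ((((Uf m (x j) : ℝ) : ℂ) * ∏ k ∈ Finset.univ.erase j, Hf m a β R (x j) (x k) ^ 2) *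
        Phi m a β R (Finset.univ.erase j) x) =
        Phi m a β R (Finset.univ.erase j) x * (-Complex.I * d +
        Complex.ofReal (2 * a * ∑ k ∈ Finset.univ.erase j,
          ((perpInv (x j - x k)).1 * v.1 + (perpInv (x j - x k)).2 * v.2)) *
        (((Uf m (x j) : ℝ) : ℂ) * ∏ k ∈ Finset.univ.erase j, Hf m a β R (x j) (x k) ^ 2)) := by
      ring
    rw [e, norm_mul]
    gcongr
  · have hz := Phi_ev_zero m a β R hx
    have h1 : pder N j v (Phi m a β R Finset.univ) x = 0 := by
      unfold pder
      rw [hz.fderiv_eq]; simp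
    rw [h1, Phi_zero m a β R hx]
    simp only [mul_zero, add_zero, norm_zero]
    have : 0 ≤ ∑ k ∈ Finset.univ.erase j, gf m β R K (x j - x k) :=
      Finset.sum_nonneg fun _ _ => gf_nonneg hβ hK0 _
    positivity

lemma DSq_le {m : ℕ} (hm : 1 ≤ m) {a β R K : ℝ} (ha : 0 ≤ a) (haβ : a ≤ β) (hβ : 0 < β)
    (hR : 0 < R) (hK : ∀ x : ℝ, |deriv Real.smoothTransition x| ≤ K) {N : ℕ} (j : Fin N)
    (x : Config N) :
    DSq N (2 * a) j (Phi m a β R Finset.univ) x ≤ ‖Phi m a β R (Finset.univ.erase j) x‖ ^ 2 *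
      (4 * (32 * π * K * m) ^ 2 +
        16 * ∑ k ∈ Finset.univ.erase j, ∑ l ∈ Finset.univ.erase j,
          gf m β R K (x j - x k) * gf m β R K (x j - x l)) := by
  have h1 := DPhi_le hm ha haβ hβ hR hK j x (1, 0) (by simp) (by simp)
  have h2 := DPhi_le hm ha haβ hβ hR hK j x (0, 1) (by simp) (by simp)
  simp only [mul_one, mul_zero, add_zero, zero_add] at h1 h2
  have q1 := pow_le_pow_left₀ (norm_nonneg _) h1 2
  have q2 := pow_le_pow_left₀ (norm_nonneg _) h2 2
  rw [← Finset.sum_mul_sum]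
  unfold DSq DOp
  simp only
  set s := ∑ k ∈ Finset.univ.erase j, gf m β R K (x j - x k)
  set A := 32 * π * K * m
  set n := ‖Phi m a β R (Finset.univ.erase j) x‖
  calc _ ≤ (n * (A + 2 * s)) ^ 2 + (n * (A + 2 * s)) ^ 2 := add_le_add q1 q2
    _ ≤ n ^ 2 * (4 * A ^ 2 + 16 * (s * s)) := by
      have : (n * (A + 2 * s)) ^ 2 + (n * (A + 2 * s)) ^ 2 = n ^ 2 * (2 * (A + 2 * s) ^ 2) := by
        ring
      rw [this]
      gcongr
      nlinarith [sq_nonneg (A - 2 * s)]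

/-! ### Integral estimates -/

/-- Lebesgue measure on the unit square. -/
def nuQ : Measure Plane := volume.restrict Q0

lemma vol_box (r s : ℝ) (d e : ℝ) (hr : 0 ≤ s - r) :
    (volume : Measure Plane) (Ioo r s ×ˢ Ioo d e) = ENNReal.ofReal ((s - r) * (e - d)) := by
  rw [Measure.volume_eq_prod, Measure.prod_prod, Real.volume_Ioo, Real.volume_Ioo,
    ← ENNReal.ofReal_mul hr]

instance nuQ_prob : IsProbabilityMeasure nuQ := by
  constructor
  unfold nuQ
  rw [Measure.restrict_apply_univ]
  unfold Q0
  rw [vol_box _ _ _ _ (by norm_num)]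
  norm_num

/-- Integrating out one coordinate. -/
lemma swap_int {N : ℕ} (j : Fin N) (f : Config N → ENNReal) (hf : Measurable f) :
    ∫⁻ x, f x ∂(Measure.pi fun _ : Fin N => nuQ) =
      ∫⁻ x, ∫⁻ y, f (Function.update x j y) ∂nuQ ∂(Measure.pi fun _ : Fin N => nuQ) := by
  apply lintegral_eq_of_lmarginal_eq (μ := fun _ : Fin N => nuQ) {j} hf
  · have := hf.lmarginal (μ := fun _ : Fin N => nuQ) (s := {j})
    rw [lmarginal_singleton] at this
    exact this
  · rw [lmarginal_singleton, lmarginal_singleton]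
    funext x
    simp

lemma int_out_le {N : ℕ} (j : Fin N) (A B : Config N → ENNReal) (hA : Measurable A)
    (hB : Measurable B) (hBj : ∀ x y, B (Function.update x j y) = B x) (c : ENNReal)
    (hc : ∀ x, ∫⁻ y, A (Function.update x j y) ∂nuQ ≤ c) :
    ∫⁻ x, A x * B x ∂(Measure.pi fun _ : Fin N => nuQ) ≤
      c * ∫⁻ x, B x ∂(Measure.pi fun _ : Fin N => nuQ) := by
  rw [swap_int j (fun x => A x * B x) (hA.mul hB), ← lintegral_const_mul c hB]
  apply lintegral_mono
  intro x
  simp only [hBj]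
  have hu : Measurable fun y => A (Function.update x j y) := hA.comp (measurable_update x)
  rw [lintegral_mul_const _ hu]
  gcongr
  exact hc x

lemma le_int_out {N : ℕ} (j : Fin N) (A B : Config N → ENNReal) (hA : Measurable A)
    (hB : Measurable B) (hBj : ∀ x y, B (Function.update x j y) = B x) (c : ENNReal)
    (hc : ∀ x, c ≤ ∫⁻ y, A (Function.update x j y) ∂nuQ) :
    c * ∫⁻ x, B x ∂(Measure.pi fun _ : Fin N => nuQ) ≤
      ∫⁻ x, A x * B x ∂(Measure.pi fun _ : Fin N => nuQ) := by
  rw [swap_int j (fun x => A x * B x) (hA.mul hB), ← lintegral_const_mul c hB]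
  apply lintegral_mono
  intro x
  simp only [hBj]
  have hu : Measurable fun y => A (Function.update x j y) := hA.comp (measurable_update x)
  rw [lintegral_mul_const _ hu]
  gcongr
  exact hc x

/-- Radial upper bound through polar coordinates. -/
lemma radial_le (F : Plane → ENNReal) (h : ℝ → ENNReal) (hh : Measurable h)
    (hF : ∀ r : ℝ, 0 < r → ∀ v : Plane, nq v = r ^ 2 → ENNReal.ofReal r * F v ≤ h r) :
    ∫⁻ v, F v ≤ ENNReal.ofReal (2 * π) * ∫⁻ r in Ioi (0:ℝ), h r := by
  rw [← lintegral_comp_polarCoord_symm]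
  have ht : polarCoord.target = Ioi (0:ℝ) ×ˢ Ioo (-π) π := rfl
  rw [ht]
  calc _ ≤ ∫⁻ p in Ioi (0:ℝ) ×ˢ Ioo (-π) π, h p.1 * (fun _ : ℝ => (1 : ENNReal)) p.2 := by
        refine setLIntegral_mono (by fun_prop) ?_
        rintro ⟨r, θ⟩ ⟨hr, -⟩
        rw [mul_one, smul_eq_mul]
        apply hF r hr
        simp only [nq, polarCoord_symm_apply]
        have := Real.sin_sq_add_cos_sq θ
        linear_combination r ^ 2 * this
    _ = _ := by
        rw [Measure.volume_eq_prod, ← Measure.prod_restrict,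
          lintegral_prod_mul hh.aemeasurable aemeasurable_const]
        rw [lintegral_const, Measure.restrict_apply_univ, Real.volume_Ioo, one_mul, mul_comm]
        congr 2
        ring

lemma meas_gf (m : ℕ) (β R K : ℝ) : Measurable (gf m β R K) := by
  have hnq : Measurable nq := by unfold nq; fun_prop
  unfold gf
  refine Measurable.ite ?_ ?_ measurable_const
  · exact (measurableSet_le measurable_const hnq).inter (measurableSet_le hnq measurable_const)
  · exact measurable_const.div (Real.continuous_sqrt.measurable.comp hnq)

lemma gf_neg (m : ℕ) (β R K : ℝ) (v : Plane) : gf m β R K (-v) = gf m β R K v := by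
  unfold gf; rw [nq_neg]

lemma gf_polar {m : ℕ} (hm : 1 ≤ m) {β R K : ℝ} (hβ : 0 < β) (hR : 0 < R) (hK : 0 ≤ K)
    {r : ℝ} (hr : 0 < r) {v : Plane} (hv : nq v = r ^ 2) :
    gf m β R K v ≤ (Icc (R * Real.exp (-(1 / β))) (2 / m)).indicator
      (fun r => 2 * (K + 1) * β / r) r := by
  have hm0 : (0:ℝ) < m := by exact_mod_cast hm
  unfold gf
  split_ifs with h
  · rw [hv, Real.sqrt_sq hr.le] at *
    rw [indicator_of_mem]
    constructor
    · have h1 := h.1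
      unfold rsq at h1
      have e : R ^ 2 * Real.exp (-(2 / β)) = (R * Real.exp (-(1 / β))) ^ 2 := by
        rw [mul_pow, ← Real.exp_nat_mul]; congr 2; push_cast; ring
      rw [e] at h1
      exact (abs_le_of_sq_le_sq' h1 hr.le).2
    · refine (abs_le_of_sq_le_sq' (h.2.trans ?_) (by positivity)).2
      rw [div_pow]
      gcongr
      norm_num
  · apply indicator_nonneg
    intro x hx
    have : 0 < x := lt_of_lt_of_le (by positivity) hx.1
    positivity

lemma G1_bound {m : ℕ} (hm : 1 ≤ m) {β R K : ℝ} (hβ : 0 < β) (hR : 0 < R) (hK : 0 ≤ K) :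
    ∫⁻ v, ENNReal.ofReal (gf m β R K v) ≤ ENNReal.ofReal (8 * π * (K + 1) * β / m) := by
  have hm0 : (0:ℝ) < m := by exact_mod_cast hm
  have hpi := Real.pi_pos
  refine (radial_le _ ((Ioc 0 (2 / (m:ℝ))).indicator
    fun _ => ENNReal.ofReal (2 * (K + 1) * β))
    (measurable_const.indicator measurableSet_Ioc) ?_).trans ?_
  · intro r hr v hv
    have h1 := gf_polar hm hβ hR hK hr hv
    rw [← ENNReal.ofReal_mul hr.le]
    by_cases hmem : r ∈ Icc (R * Real.exp (-(1 / β))) (2 / (m:ℝ))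
    · rw [indicator_of_mem hmem] at h1
      have hm2 : r ∈ Ioc (0:ℝ) (2 / (m:ℝ)) := ⟨hr, hmem.2⟩
      rw [indicator_of_mem hm2]
      apply ENNReal.ofReal_le_ofReal
      calc r * gf m β R K v ≤ r * (2 * (K + 1) * β / r) := by gcongr
        _ = _ := by field_simp
    · rw [indicator_of_notMem hmem] at h1
      have : ENNReal.ofReal (r * gf m β R K v) = 0 := by
        rw [ENNReal.ofReal_eq_zero]; nlinarith
      rw [this]; exact zero_le
  · rw [lintegral_indicator measurableSet_Ioc, Measure.restrict_restrict measurableSet_Ioc,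
      lintegral_const, Measure.restrict_apply_univ]
    have : volume (Ioc 0 (2 / (m:ℝ)) ∩ Ioi 0) ≤ ENNReal.ofReal (2 / m) := by
      refine (measure_mono inter_subset_left).trans ?_
      rw [Real.volume_Ioc, sub_zero]
    calc _ ≤ ENNReal.ofReal (2 * π) * (ENNReal.ofReal (2 * (K + 1) * β) *
          ENNReal.ofReal (2 / m)) := by gcongr
      _ = _ := by
        rw [← ENNReal.ofReal_mul (by positivity), ← ENNReal.ofReal_mul (by positivity)]
        congr 1; ring

lemma G2_bound {m : ℕ} (hm : 1 ≤ m) {β R K : ℝ} (hβ : 0 < β) (hR : 0 < R) (hK : 0 ≤ K)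
    (hRm : R ≤ 2 / m) :
    ∫⁻ v, ENNReal.ofReal (gf m β R K v * gf m β R K v) ≤
      ENNReal.ofReal (8 * π * (K + 1) ^ 2 * β ^ 2 * (2 / (m * R) + 1 / β)) := by
  have hm0 : (0:ℝ) < m := by exact_mod_cast hm
  have hpi := Real.pi_pos
  set ρ := R * Real.exp (-(1 / β)) with hρ
  have hρ0 : 0 < ρ := by positivity
  have hρR : ρ ≤ R := by
    have : Real.exp (-(1 / β)) ≤ 1 := Real.exp_le_one_iff.2 (by
      have : 0 < 1 / β := by positivity
      linarith)
    rw [hρ]; nlinarith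
  have hρm : ρ ≤ 2 / m := hρR.trans hRm
  refine (radial_le _ ((Icc ρ (2 / (m:ℝ))).indicator
    fun r => ENNReal.ofReal (4 * (K + 1) ^ 2 * β ^ 2 * (1 / r)))
    (Measurable.indicator (by fun_prop) measurableSet_Icc) ?_).trans ?_
  · intro r hr v hv
    have h1 := gf_polar hm hβ hR hK hr hv
    have h0 := gf_nonneg (m := m) (R := R) hβ hK v
    rw [← ENNReal.ofReal_mul hr.le]
    by_cases hmem : r ∈ Icc ρ (2 / (m:ℝ))
    · rw [indicator_of_mem hmem] at h1
      rw [indicator_of_mem hmem]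
      apply ENNReal.ofReal_le_ofReal
      calc r * (gf m β R K v * gf m β R K v) ≤
            r * ((2 * (K + 1) * β / r) * (2 * (K + 1) * β / r)) := by gcongr
        _ = _ := by field_simp; norm_num
    · rw [indicator_of_notMem hmem] at h1
      have h2 : gf m β R K v = 0 := le_antisymm h1 h0
      rw [h2]; simp
  · rw [lintegral_indicator measurableSet_Icc, Measure.restrict_restrict measurableSet_Icc]
    have hsub : Icc ρ (2 / (m:ℝ)) ∩ Ioi 0 = Icc ρ (2 / (m:ℝ)) :=
      inter_eq_left.2 fun r hr => lt_of_lt_of_le hρ0 hr.1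
    rw [hsub]
    have hci : ContinuousOn (fun r : ℝ => 4 * (K + 1) ^ 2 * β ^ 2 * (1 / r)) (Icc ρ (2 / (m:ℝ))) := by
      refine continuousOn_const.mul (continuousOn_const.div continuousOn_id ?_)
      intro r hr
      exact (lt_of_lt_of_le hρ0 hr.1).ne'
    rw [← ofReal_integral_eq_lintegral_ofReal (hci.integrableOn_Icc) ?_]
    · rw [integral_Icc_eq_integral_Ioc, ← intervalIntegral.integral_of_le hρm,
        intervalIntegral.integral_const_mul, integral_one_div_of_pos hρ0 (by positivity),
        ← ENNReal.ofReal_mul (by positivity)]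
      apply ENNReal.ofReal_le_ofReal
      have hlog : Real.log (2 / m / ρ) ≤ 2 / (m * R) + 1 / β := by
        have e : 2 / (m:ℝ) / ρ = (2 / (m * R)) * Real.exp (1 / β) := by
          rw [hρ, Real.exp_neg]; field_simp
        rw [e, Real.log_mul (by positivity) (by positivity), Real.log_exp]
        have := Real.log_le_sub_one_of_pos (x := 2 / (m * R)) (by positivity)
        linarith
      calc _ ≤ 2 * π * (4 * (K + 1) ^ 2 * β ^ 2 * (2 / (m * R) + 1 / β)) := by gcongr
        _ = _ := by ring
    · refine (ae_restrict_iff' measurableSet_Icc).2 (Filter.Eventually.of_forall fun r hr => ?_)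
      have : 0 < r := lt_of_lt_of_le hρ0 hr.1
      simp only [Pi.zero_apply]
      positivity

lemma one_sub_sum_le {ι : Type*} [DecidableEq ι] (S : Finset ι) (b : ι → ℝ)
    (h0 : ∀ k ∈ S, 0 ≤ b k) (h1 : ∀ k ∈ S, b k ≤ 1) :
    1 ≤ ∏ k ∈ S, b k + ∑ k ∈ S, (1 - b k) := by
  induction S using Finset.induction_on with
  | empty => simp
  | insert i S hi ih =>
    have ih' := ih (fun k hk => h0 k (Finset.mem_insert_of_mem hk))
      (fun k hk => h1 k (Finset.mem_insert_of_mem hk))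
    have hp : ∏ k ∈ S, b k ≤ 1 := Finset.prod_le_one
      (fun k hk => h0 k (Finset.mem_insert_of_mem hk))
      (fun k hk => h1 k (Finset.mem_insert_of_mem hk))
    rw [Finset.prod_insert hi, Finset.sum_insert hi]
    have a0 := h0 i (Finset.mem_insert_self i S)
    have a1 := h1 i (Finset.mem_insert_self i S)
    nlinarith

/-- One-particle lower bound. -/
lemma one_lower {m : ℕ} (hm : 1 ≤ m) {a β R : ℝ} (hβ : 0 < β) (hR : 0 < R) {N : ℕ}
    (hNR : N * (4 * R ^ 2) ≤ 1 / 18) (S : Finset (Fin N)) (x : Config N) :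
    ENNReal.ofReal (1 / 18) ≤ ∫⁻ y, ENNReal.ofReal
      (‖(Uf m y : ℂ) * ∏ k ∈ S, Hf m a β R y (x k) ^ 2‖ ^ 2) ∂nuQ := by
  set box : Fin N → Set Plane := fun k =>
    Ioo ((x k).1 - R) ((x k).1 + R) ×ˢ Ioo ((x k).2 - R) ((x k).2 + R) with hbox
  have hmb : ∀ k, MeasurableSet (box k) := fun k => measurableSet_Ioo.prod measurableSet_Ioo
  have hpt : ∀ y, ENNReal.ofReal (Uf m y ^ 2) ≤
      ENNReal.ofReal (‖(Uf m y : ℂ) * ∏ k ∈ S, Hf m a β R y (x k) ^ 2‖ ^ 2) +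
        ∑ k ∈ S, (box k).indicator (fun _ => (1 : ENNReal)) y := by
    intro y
    have hind : ∀ k, ENNReal.ofReal (1 - ‖Hf m a β R y (x k)‖ ^ 4) ≤
        (box k).indicator (fun _ => (1 : ENNReal)) y := by
      intro k
      by_cases hk : y ∈ box k
      · rw [indicator_of_mem hk]
        rw [← ENNReal.ofReal_one]
        apply ENNReal.ofReal_le_ofReal
        have : 0 ≤ ‖Hf m a β R y (x k)‖ ^ 4 := by positivity
        linarith
      · have : R ^ 2 ≤ nq (y - x k) := by
          by_contra hc
          push Not at hc
          apply hk
          simp only [nq, Prod.fst_sub, Prod.snd_sub] at hc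
          have c1 := abs_lt_of_sq_lt_sq' (a := y.1 - (x k).1) (b := R)
            (by nlinarith [sq_nonneg (y.2 - (x k).2)]) hR.le
          have c2 := abs_lt_of_sq_lt_sq' (a := y.2 - (x k).2) (b := R)
            (by nlinarith [sq_nonneg (y.1 - (x k).1)]) hR.le
          exact ⟨⟨by linarith [c1.1], by linarith [c1.2]⟩, ⟨by linarith [c2.1], by linarith [c2.2]⟩⟩
        rw [Hf_norm_one hβ hR y (x k) this]
        simp
    have hreal : Uf m y ^ 2 ≤ ‖(Uf m y : ℂ) * ∏ k ∈ S, Hf m a β R y (x k) ^ 2‖ ^ 2 +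
        ∑ k ∈ S, (1 - ‖Hf m a β R y (x k)‖ ^ 4) := by
      have h1 : ∀ k ∈ S, ‖Hf m a β R y (x k)‖ ^ 4 ≤ 1 := fun k _ =>
        pow_le_one₀ (norm_nonneg _) (Hf_norm_le _ _ _ _ _ _)
      have hw := one_sub_sum_le S (fun k => ‖Hf m a β R y (x k)‖ ^ 4)
        (fun k _ => by positivity) h1
      have e : ‖(Uf m y : ℂ) * ∏ k ∈ S, Hf m a β R y (x k) ^ 2‖ ^ 2 =
          Uf m y ^ 2 * ∏ k ∈ S, ‖Hf m a β R y (x k)‖ ^ 4 := by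
        rw [norm_mul, mul_pow, Complex.norm_real, Real.norm_eq_abs, sq_abs, norm_prod,
          ← Finset.prod_pow]
        congr 1
        refine Finset.prod_congr rfl fun k _ => ?_
        rw [norm_pow]; ring
      rw [e]
      have hs : 0 ≤ ∑ k ∈ S, (1 - ‖Hf m a β R y (x k)‖ ^ 4) :=
        Finset.sum_nonneg fun k hk => by linarith [h1 k hk]
      have hU : Uf m y ^ 2 ≤ 1 := pow_le_one₀ (Uf_nonneg _ _) (Uf_le_one _ _)
      have hU0 := sq_nonneg (Uf m y)
      nlinarith
    calc _ ≤ _ := ENNReal.ofReal_le_ofReal hreal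
      _ ≤ _ := ENNReal.ofReal_add_le
      _ ≤ _ := by
        gcongr
        rw [ENNReal.ofReal_sum_of_nonneg]
        · exact Finset.sum_le_sum fun k _ => hind k
        · intro k _
          have := pow_le_one₀ (n := 4) (norm_nonneg _) (Hf_norm_le m a β R y (x k))
          linarith
  have hlow := (Uf_int m hm).trans (lintegral_mono hpt)
  have hmi : Measurable fun y => ∑ k ∈ S, (box k).indicator (fun _ => (1 : ENNReal)) y :=
    Finset.measurable_fun_sum _ fun k _ => measurable_const.indicator (hmb k)
  rw [lintegral_add_right _ hmi] at hlow
  have hsum : ∫⁻ y in Q0, ∑ k ∈ S, (box k).indicator (fun _ => (1 : ENNReal)) y ≤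
      ENNReal.ofReal (1 / 18) := by
    rw [lintegral_finsetSum _ fun k _ => measurable_const.indicator (hmb k)]
    calc _ ≤ ∑ k ∈ S, ENNReal.ofReal (4 * R ^ 2) := by
          refine Finset.sum_le_sum fun k _ => ?_
          rw [lintegral_indicator (hmb k), setLIntegral_one]
          refine (Measure.restrict_apply_le _ _).trans ?_
          rw [hbox, vol_box _ _ _ _ (by linarith)]
          apply ENNReal.ofReal_le_ofReal
          apply le_of_eq; ring
      _ = ENNReal.ofReal (S.card * (4 * R ^ 2)) := by
          rw [Finset.sum_const, nsmul_eq_mul, ENNReal.ofReal_mul (p := (S.card:ℝ)) (by positivity),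
            ENNReal.ofReal_natCast]
      _ ≤ _ := by
          apply ENNReal.ofReal_le_ofReal
          refine le_trans ?_ hNR
          gcongr
          simpa using Finset.card_le_univ S
  have h19 : ENNReal.ofReal (1 / 9) = ENNReal.ofReal (1 / 18) + ENNReal.ofReal (1 / 18) := by
    rw [← ENNReal.ofReal_add (by norm_num) (by norm_num)]; norm_num
  rw [h19] at hlow
  have := hlow.trans (add_le_add le_rfl hsum)
  exact ENNReal.le_of_add_le_add_right ENNReal.ofReal_ne_top this

/-! ### Many-body integrals -/

/-- Normalised Lebesgue measure on configurations in the unit square. -/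
def nuN (N : ℕ) : Measure (Config N) := Measure.pi fun _ : Fin N => nuQ

instance nuN_prob (N : ℕ) : IsProbabilityMeasure (nuN N) := by unfold nuN; infer_instance

lemma nuN_eq (N : ℕ) : (volume : Measure (Config N)).restrict (cube N Q0) = nuN N := by
  unfold nuN nuQ cube
  rw [volume_pi, Measure.restrict_pi_pi]

/-- The density of the trial function. -/
def Wf (m : ℕ) (a β R : ℝ) {N : ℕ} (S : Finset (Fin N)) (x : Config N) : ENNReal :=
  ENNReal.ofReal (‖Phi m a β R S x‖ ^ 2)

lemma meas_Uf (m : ℕ) : Measurable (Uf m) := (Uf_contDiff m).continuous.measurable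

lemma meas_Hf2 {m : ℕ} {a β R : ℝ} (hβ : 0 < β) (hR : 0 < R) {N : ℕ} (j k : Fin N) :
    Measurable fun x : Config N => Hf m a β R (x j) (x k) := by
  have h : Measurable fun x : Config N => (x j, x k) := by fun_prop
  exact (meas_Hf m a β R hβ hR).comp h

lemma meas_Phi {m : ℕ} {a β R : ℝ} (hβ : 0 < β) (hR : 0 < R) {N : ℕ}
    (S : Finset (Fin N)) : Measurable (Phi m a β R S) := by
  unfold Phi
  refine Measurable.mul ?_ ?_
  · refine Finset.measurable_fun_prod _ fun k _ => ?_
    exact Complex.measurable_ofReal.comp ((meas_Uf m).comp (measurable_pi_apply k))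
  · refine Finset.measurable_fun_prod _ fun p _ => ?_
    exact meas_Hf2 hβ hR p.1 p.2

lemma meas_Wf {m : ℕ} {a β R : ℝ} (hβ : 0 < β) (hR : 0 < R) {N : ℕ}
    (S : Finset (Fin N)) : Measurable (Wf m a β R S) :=
  ENNReal.measurable_ofReal.comp ((meas_Phi hβ hR S).norm.pow_const 2)

lemma Wf_update (m : ℕ) (a β R : ℝ) {N : ℕ} {S : Finset (Fin N)} {j : Fin N} (hj : j ∉ S)
    (x : Config N) (y : Plane) : Wf m a β R S (Function.update x j y) = Wf m a β R S x := by
  unfold Wf; rw [Phi_update m a β R hj]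

lemma Wf_insert (m : ℕ) (a β R : ℝ) {N : ℕ} {S : Finset (Fin N)} {j : Fin N} (hj : j ∉ S)
    (x : Config N) : Wf m a β R (insert j S) x =
      ENNReal.ofReal (‖(Uf m (x j) : ℂ) * ∏ k ∈ S, Hf m a β R (x j) (x k) ^ 2‖ ^ 2) *
        Wf m a β R S x := by
  unfold Wf
  rw [Phi_insert m a β R hj, norm_mul, mul_pow, ENNReal.ofReal_mul (by positivity)]

lemma Wf_insert_le (m : ℕ) (a β R : ℝ) {N : ℕ} {S : Finset (Fin N)} {j : Fin N} (hj : j ∉ S)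
    (x : Config N) : Wf m a β R (insert j S) x ≤ Wf m a β R S x := by
  rw [Wf_insert m a β R hj]
  refine mul_le_of_le_one_left (by simp) ?_
  rw [ENNReal.ofReal_le_one]
  refine pow_le_one₀ (norm_nonneg _) ?_
  rw [norm_mul, norm_prod, Complex.norm_real, Real.norm_eq_abs, abs_of_nonneg (Uf_nonneg _ _)]
  refine mul_le_one₀ (Uf_le_one _ _) (Finset.prod_nonneg fun _ _ => norm_nonneg _)
    (Finset.prod_le_one (fun _ _ => norm_nonneg _) fun k _ => ?_)
  rw [norm_pow]
  exact pow_le_one₀ (norm_nonneg _) (Hf_norm_le _ _ _ _ _ _)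

lemma Z_insert {m : ℕ} (hm : 1 ≤ m) {a β R : ℝ} (hβ : 0 < β) (hR : 0 < R) {N : ℕ}
    (hNR : N * (4 * R ^ 2) ≤ 1 / 18) {S : Finset (Fin N)} {j : Fin N} (hj : j ∉ S) :
    ∫⁻ x, Wf m a β R S x ∂nuN N ≤ 18 * ∫⁻ x, Wf m a β R (insert j S) x ∂nuN N := by
  have h := le_int_out j (fun x => ENNReal.ofReal
      (‖(Uf m (x j) : ℂ) * ∏ k ∈ S, Hf m a β R (x j) (x k) ^ 2‖ ^ 2)) (Wf m a β R S) ?_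
      (meas_Wf hβ hR S) (Wf_update m a β R hj) (ENNReal.ofReal (1 / 18)) ?_
  · simp only [← Wf_insert m a β R hj] at h
    change _ ≤ ∫⁻ x, Wf m a β R (insert j S) x ∂nuN N at h
    calc ∫⁻ x, Wf m a β R S x ∂nuN N
        = 18 * (ENNReal.ofReal (1 / 18) * ∫⁻ x, Wf m a β R S x ∂nuN N) := by
          rw [← mul_assoc]
          have : (18 : ENNReal) = ENNReal.ofReal 18 := by simp
          rw [this, ← ENNReal.ofReal_mul (by norm_num)]
          norm_num
      _ ≤ _ := by gcongr; exact h
  · refine ENNReal.measurable_ofReal.comp (Measurable.pow_const (Measurable.norm ?_) 2)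
    refine Measurable.mul ?_ ?_
    · exact Complex.measurable_ofReal.comp ((meas_Uf m).comp (measurable_pi_apply j))
    · refine Finset.measurable_fun_prod _ fun k _ => Measurable.pow_const ?_ 2
      exact meas_Hf2 hβ hR j k
  · intro x
    refine (one_lower hm hβ hR hNR S x (a := a)).trans (le_of_eq ?_)
    refine lintegral_congr fun y => ?_
    have e : ∏ k ∈ S, Hf m a β R y (x k) ^ 2 =
        ∏ k ∈ S, Hf m a β R y (Function.update x j y k) ^ 2 := by
      refine Finset.prod_congr rfl fun k hk => ?_
      have h1 : k ≠ j := fun h => hj (h ▸ hk)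
      rw [Function.update_of_ne h1]
    rw [e, Function.update_self]

lemma Z_pos {m : ℕ} (hm : 1 ≤ m) {a β R : ℝ} (hβ : 0 < β) (hR : 0 < R) {N : ℕ}
    (hNR : N * (4 * R ^ 2) ≤ 1 / 18) (S : Finset (Fin N)) :
    ∫⁻ x, Wf m a β R S x ∂nuN N ≠ 0 := by
  induction S using Finset.induction_on with
  | empty => simp [Wf, Phi]
  | insert j S hj ih =>
    intro h0
    have := Z_insert hm hβ hR hNR hj (a := a)
    rw [h0, mul_zero] at this
    exact ih (le_antisymm this (by simp))

lemma Wf_le_one (m : ℕ) (a β R : ℝ) {N : ℕ} (S : Finset (Fin N)) (x : Config N) :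
    Wf m a β R S x ≤ 1 := by
  induction S using Finset.induction_on with
  | empty => simp [Wf, Phi]
  | insert j S hj ih => exact (Wf_insert_le m a β R hj x).trans ih

lemma Z_fin (m : ℕ) (a β R : ℝ) {N : ℕ} (S : Finset (Fin N)) :
    ∫⁻ x, Wf m a β R S x ∂nuN N ≠ ⊤ := by
  refine ne_top_of_le_ne_top ENNReal.one_ne_top ((lintegral_mono (Wf_le_one m a β R S)).trans ?_)
  simp

/-- Bound on one-variable integrals of shifted functions. -/
lemma shift_le (f : Plane → ENNReal) (hf : ∀ v, f (-v) = f v) (z : Plane) :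
    ∫⁻ y, f (y - z) ∂nuQ ≤ ∫⁻ v, f v ∧ ∫⁻ y, f (z - y) ∂nuQ ≤ ∫⁻ v, f v := by
  have h1 : ∫⁻ y, f (y - z) ∂nuQ ≤ ∫⁻ v, f v := by
    refine (setLIntegral_le_lintegral _ _).trans (le_of_eq ?_)
    exact lintegral_sub_right_eq_self f z
  refine ⟨h1, le_trans (le_of_eq ?_) h1⟩
  refine lintegral_congr fun y => ?_
  rw [← hf, neg_sub]

lemma pair_same {m : ℕ} (hm : 1 ≤ m) {a β R K : ℝ} (hβ : 0 < β) (hR : 0 < R) (hK : 0 ≤ K)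
    (hRm : R ≤ 2 / m) {N : ℕ} {j k : Fin N} (hkj : k ≠ j) :
    ∫⁻ x, ENNReal.ofReal (gf m β R K (x j - x k) * gf m β R K (x j - x k)) *
        Wf m a β R (Finset.univ.erase j) x ∂nuN N ≤
      ENNReal.ofReal (8 * π * (K + 1) ^ 2 * β ^ 2 * (2 / (m * R) + 1 / β)) *
        ∫⁻ x, Wf m a β R (Finset.univ.erase j) x ∂nuN N := by
  have hg := meas_gf m β R K
  refine int_out_le j (fun x => ENNReal.ofReal (gf m β R K (x j - x k) * gf m β R K (x j - x k)))
    _ ?_ (meas_Wf hβ hR _) (Wf_update m a β R (by simp)) _ ?_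
  · have h1 : Measurable fun x : Config N => gf m β R K (x j - x k) := hg.comp (by fun_prop)
    exact ENNReal.measurable_ofReal.comp (h1.mul h1)
  · intro x
    simp only [Function.update_self, Function.update_of_ne hkj]
    refine ((shift_le (fun v => ENNReal.ofReal (gf m β R K v * gf m β R K v)) ?_ (x k)).1).trans
      (G2_bound hm hβ hR hK hRm)
    intro v; simp only [gf_neg]

lemma pair_diff {m : ℕ} (hm : 1 ≤ m) {a β R K : ℝ} (hβ : 0 < β) (hR : 0 < R) (hK : 0 ≤ K)
    {N : ℕ} (hNR : N * (4 * R ^ 2) ≤ 1 / 18) {j k l : Fin N} (hkj : k ≠ j) (hlj : l ≠ j)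
    (hkl : k ≠ l) :
    ∫⁻ x, ENNReal.ofReal (gf m β R K (x j - x k) * gf m β R K (x j - x l)) *
        Wf m a β R (Finset.univ.erase j) x ∂nuN N ≤
      ENNReal.ofReal (18 * (8 * π * (K + 1) * β / m) ^ 2) *
        ∫⁻ x, Wf m a β R (Finset.univ.erase j) x ∂nuN N := by
  have hpi := Real.pi_pos
  have hm0 : (0:ℝ) < m := by exact_mod_cast hm
  have hg := meas_gf m β R K
  set G := ENNReal.ofReal (8 * π * (K + 1) * β / m) with hG
  set T : Finset (Fin N) := (Finset.univ.erase j).erase k with hT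
  have hkT : k ∉ T := by simp [hT]
  have hjT : j ∉ T := by simp [hT]
  have hins : insert k T = Finset.univ.erase j := by
    rw [hT]; exact Finset.insert_erase (by simp [hkj])
  have hgm : ∀ i : Fin N, Measurable fun x : Config N => ENNReal.ofReal (gf m β R K (x j - x i)) :=
    fun i => ENNReal.measurable_ofReal.comp (hg.comp (by fun_prop))
  have hsym : ∀ v, ENNReal.ofReal (gf m β R K (-v)) = ENNReal.ofReal (gf m β R K v) :=
    fun v => by rw [gf_neg]
  have s1 := int_out_le k (fun x => ENNReal.ofReal (gf m β R K (x j - x k)))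
    (fun x => ENNReal.ofReal (gf m β R K (x j - x l)) * Wf m a β R T x) (hgm k)
    ((hgm l).mul (meas_Wf hβ hR T))
    (fun x y => by
      simp only [Wf_update m a β R hkT, Function.update_of_ne hkj.symm,
        Function.update_of_ne hkl.symm]) G
    (fun x => by
      simp only [Function.update_self, Function.update_of_ne hkj.symm]
      exact ((shift_le (fun v => ENNReal.ofReal (gf m β R K v)) hsym (x j)).2).trans
        (G1_bound hm hβ hR hK))
  have s2 := int_out_le j (fun x => ENNReal.ofReal (gf m β R K (x j - x l)))
    (fun x => Wf m a β R T x) (hgm l) (meas_Wf hβ hR T)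
    (fun x y => Wf_update m a β R hjT x y) G
    (fun x => by
      simp only [Function.update_self, Function.update_of_ne hlj]
      exact ((shift_le (fun v => ENNReal.ofReal (gf m β R K v)) hsym (x l)).1).trans
        (G1_bound hm hβ hR hK))
  have s3 := Z_insert hm hβ hR hNR hkT (a := a)
  rw [hins] at s3
  calc _ ≤ ∫⁻ x, ENNReal.ofReal (gf m β R K (x j - x k)) *
          (ENNReal.ofReal (gf m β R K (x j - x l)) * Wf m a β R T x) ∂nuN N := by
        refine lintegral_mono fun x => ?_
        rw [ENNReal.ofReal_mul (gf_nonneg hβ hK _), mul_assoc, ← hins]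
        gcongr
        exact Wf_insert_le m a β R hkT x
    _ ≤ G * (G * (18 * ∫⁻ x, Wf m a β R (Finset.univ.erase j) x ∂nuN N)) := by
        refine s1.trans ?_
        gcongr
        refine s2.trans ?_
        gcongr
        exact s3
    _ = _ := by
        rw [ENNReal.ofReal_mul (by norm_num), ENNReal.ofReal_pow (by positivity), ← hG]
        have : (18 : ENNReal) = ENNReal.ofReal 18 := by simp
        rw [← this]
        ring

/-- Kinetic energy bound for one particle. -/
lemma kin_one {m : ℕ} (hm : 1 ≤ m) {a β R K : ℝ} (ha : 0 ≤ a) (haβ : a ≤ β) (hβ : 0 < β)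
    (hR : 0 < R) (hK0 : 0 ≤ K) (hK : ∀ x : ℝ, |deriv Real.smoothTransition x| ≤ K)
    (hRm : R ≤ 2 / m)
    {N : ℕ} (hNR : N * (4 * R ^ 2) ≤ 1 / 18) (j : Fin N) :
    ∫⁻ x, ENNReal.ofReal (DSq N (2 * a) j (Phi m a β R Finset.univ) x) ∂nuN N ≤
      ENNReal.ofReal (18 * (4 * (32 * π * K * m) ^ 2 +
        16 * (N * (8 * π * (K + 1) ^ 2 * β ^ 2 * (2 / (m * R) + 1 / β)) +
          N ^ 2 * (18 * (8 * π * (K + 1) * β / m) ^ 2)))) *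
        ∫⁻ x, Wf m a β R (Finset.univ : Finset (Fin N)) x ∂nuN N := by
  have hpi := Real.pi_pos
  have hm0 : (0:ℝ) < m := by exact_mod_cast hm
  set G2 := 8 * π * (K + 1) ^ 2 * β ^ 2 * (2 / (m * R) + 1 / β) with hG2
  set G1 := 18 * (8 * π * (K + 1) * β / m) ^ 2 with hG1
  set A := 4 * (32 * π * K * m) ^ 2 with hA
  have hG20 : 0 ≤ G2 := by positivity
  have hG10 : 0 ≤ G1 := by positivity
  have hA0 : 0 ≤ A := by positivity
  set E : Finset (Fin N) := Finset.univ.erase j with hE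
  have hgm : ∀ i : Fin N, Measurable fun x : Config N => gf m β R K (x j - x i) :=
    fun i => (meas_gf m β R K).comp (by fun_prop)
  set Z := ∫⁻ x, Wf m a β R E x ∂nuN N with hZ
  have hgg : ∀ (x : Config N) k l, 0 ≤ gf m β R K (x j - x k) * gf m β R K (x j - x l) :=
    fun x k l => mul_nonneg (gf_nonneg hβ hK0 _) (gf_nonneg hβ hK0 _)
  have hpair : ∀ k ∈ E, ∀ l ∈ E,
      ∫⁻ x, ENNReal.ofReal (gf m β R K (x j - x k) * gf m β R K (x j - x l)) *
        Wf m a β R E x ∂nuN N ≤ ENNReal.ofReal ((if k = l then G2 else 0) + G1) * Z := by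
    intro k hk l hl
    have hkj : k ≠ j := Finset.ne_of_mem_erase hk
    have hlj : l ≠ j := Finset.ne_of_mem_erase hl
    by_cases hkl : k = l
    · subst hkl
      refine (pair_same hm hβ hR hK0 hRm hkj).trans ?_
      rw [if_pos rfl]
      gcongr
      linarith
    · refine (pair_diff hm hβ hR hK0 hNR hkj hlj hkl).trans ?_
      rw [if_neg hkl]
      gcongr
      linarith
  have hcard : (E.card : ℝ) ≤ N := by
    have := Finset.card_le_univ E
    simp only [Fintype.card_fin] at this
    exact_mod_cast this
  have hsumle : ∑ k ∈ E, ∑ l ∈ E, ((if k = l then G2 else 0) + G1) ≤ N * G2 + N ^ 2 * G1 := by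
    have e : ∑ k ∈ E, ∑ l ∈ E, ((if k = l then G2 else 0) + G1) =
        E.card * G2 + (E.card : ℝ) ^ 2 * G1 := by
      simp only [Finset.sum_add_distrib, Finset.sum_ite_eq, Finset.sum_const, nsmul_eq_mul]
      congr 1
      · rw [Finset.sum_ite_mem, Finset.inter_self, Finset.sum_const, nsmul_eq_mul]
      · ring
    rw [e]
    gcongr
  have hWm := meas_Wf hβ hR E (m := m) (a := a)
  have hmain : ∫⁻ x, ENNReal.ofReal (DSq N (2 * a) j (Phi m a β R Finset.univ) x) ∂nuN N ≤
      ENNReal.ofReal (A + 16 * (N * G2 + N ^ 2 * G1)) * Z := by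
    calc _ ≤ ∫⁻ x, (ENNReal.ofReal A * Wf m a β R E x + 16 * ∑ k ∈ E, ∑ l ∈ E,
          ENNReal.ofReal (gf m β R K (x j - x k) * gf m β R K (x j - x l)) *
            Wf m a β R E x) ∂nuN N := by
          refine lintegral_mono fun x => ?_
          refine (ENNReal.ofReal_le_ofReal (DSq_le hm ha haβ hβ hR hK j x)).trans (le_of_eq ?_)
          rw [ENNReal.ofReal_mul (by positivity), ENNReal.ofReal_add hA0
            (mul_nonneg (by norm_num) (Finset.sum_nonneg fun k _ => Finset.sum_nonneg fun l _ =>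
              hgg x k l)), ENNReal.ofReal_mul (p := 16) (by norm_num),
            ENNReal.ofReal_sum_of_nonneg (fun k _ => Finset.sum_nonneg fun l _ => hgg x k l)]
          have e : ∀ k ∈ E, ENNReal.ofReal (∑ l ∈ E, gf m β R K (x j - x k) * gf m β R K (x j - x l))
              = ∑ l ∈ E, ENNReal.ofReal (gf m β R K (x j - x k) * gf m β R K (x j - x l)) :=
            fun k _ => ENNReal.ofReal_sum_of_nonneg (fun l _ => hgg x k l)
          rw [Finset.sum_congr rfl e]
          have : ENNReal.ofReal 16 = (16 : ENNReal) := by simp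
          rw [this]
          simp only [← Finset.sum_mul]
          change Wf m a β R E x * _ = _
          ring
      _ = ENNReal.ofReal A * Z + 16 * ∑ k ∈ E, ∑ l ∈ E,
          ∫⁻ x, ENNReal.ofReal (gf m β R K (x j - x k) * gf m β R K (x j - x l)) *
            Wf m a β R E x ∂nuN N := by
          have hkl : ∀ k l, Measurable fun x : Config N =>
              ENNReal.ofReal (gf m β R K (x j - x k) * gf m β R K (x j - x l)) *
                Wf m a β R E x := fun k l =>
            (ENNReal.measurable_ofReal.comp ((hgm k).mul (hgm l))).mul hWm
          rw [lintegral_add_left (hWm.const_mul _), lintegral_const_mul _ hWm,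
            lintegral_const_mul _ (Finset.measurable_fun_sum _ fun k _ =>
              Finset.measurable_fun_sum _ fun l _ => hkl k l),
            lintegral_finsetSum _ (fun k _ => Finset.measurable_fun_sum _ fun l _ => hkl k l)]
          congr 2
          refine Finset.sum_congr rfl fun k _ => ?_
          rw [lintegral_finsetSum _ (fun l _ => hkl k l)]
      _ ≤ ENNReal.ofReal A * Z + 16 * ∑ k ∈ E, ∑ l ∈ E,
          ENNReal.ofReal ((if k = l then G2 else 0) + G1) * Z := by
          gcongr with k hk l hl
          exact hpair k hk l hl
      _ = ENNReal.ofReal (A + 16 * ∑ k ∈ E, ∑ l ∈ E, ((if k = l then G2 else 0) + G1)) * Z := by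
          have h0 : ∀ k l : Fin N, 0 ≤ (if k = l then G2 else 0) + G1 := by
            intro k l; split_ifs <;> positivity
          have h00 : ∀ k : Fin N, 0 ≤ ∑ l ∈ E, ((if k = l then G2 else 0) + G1) :=
            fun k => Finset.sum_nonneg fun l _ => h0 k l
          rw [ENNReal.ofReal_add hA0 (mul_nonneg (by norm_num)
            (Finset.sum_nonneg fun k _ => h00 k)), ENNReal.ofReal_mul (p := 16) (by norm_num),
            ENNReal.ofReal_sum_of_nonneg (fun k _ => h00 k)]
          have e : ∀ k ∈ E, ENNReal.ofReal (∑ l ∈ E, ((if k = l then G2 else 0) + G1))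
              = ∑ l ∈ E, ENNReal.ofReal ((if k = l then G2 else 0) + G1) :=
            fun k _ => ENNReal.ofReal_sum_of_nonneg (fun l _ => h0 k l)
          rw [Finset.sum_congr rfl e]
          have : ENNReal.ofReal 16 = (16 : ENNReal) := by simp
          rw [this]
          simp only [← Finset.sum_mul]
          ring
      _ ≤ _ := by gcongr
  have hins : insert j E = Finset.univ := by
    rw [hE]; exact Finset.insert_erase (by simp)
  have hZi := Z_insert hm hβ hR hNR (a := a) (S := E) (j := j) (by simp [hE])
  rw [hins] at hZi
  refine hmain.trans ?_
  calc _ ≤ ENNReal.ofReal (A + 16 * (N * G2 + N ^ 2 * G1)) *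
        (18 * ∫⁻ x, Wf m a β R (Finset.univ : Finset (Fin N)) x ∂nuN N) := by gcongr
    _ = _ := by
      rw [ENNReal.ofReal_mul (by norm_num)]
      have : ENNReal.ofReal 18 = (18 : ENNReal) := by simp
      rw [this]; ring

/-! ### Normalisation and conclusion -/

lemma DSq_nonneg (N : ℕ) (α : ℝ) (j : Fin N) (Ψ : Config N → ℂ) (x : Config N) :
    0 ≤ DSq N α j Ψ x := by unfold DSq; positivity

lemma kinE_nonneg (N : ℕ) (α : ℝ) (Ω : Set Plane) (Ψ : Config N → ℂ) : 0 ≤ kinE N α Ω Ψ :=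
  Finset.sum_nonneg fun _ _ => integral_nonneg fun _ => DSq_nonneg _ _ _ _ _

lemma DSq_scale (N : ℕ) (α : ℝ) (j : Fin N) {Ψ : Config N → ℂ} (h : Differentiable ℝ Ψ) (c : ℝ)
    (x : Config N) : DSq N α j (fun x => (c : ℂ) * Ψ x) x = c ^ 2 * DSq N α j Ψ x := by
  have hp : ∀ v, pder N j v (fun x => (c : ℂ) * Ψ x) x = c * pder N j v Ψ x := by
    intro v
    unfold pder
    rw [fderiv_const_mul (h x)]
    rfl
  unfold DSq DOp
  simp only [hp]
  have e : ∀ p q : ℂ, ‖-Complex.I * ((c:ℂ) * p) + q * ((c:ℂ) * Ψ x)‖ ^ 2 =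
      c ^ 2 * ‖-Complex.I * p + q * Ψ x‖ ^ 2 := by
    intro p q
    have : -Complex.I * ((c:ℂ) * p) + q * ((c:ℂ) * Ψ x) = c * (-Complex.I * p + q * Ψ x) := by ring
    rw [this, norm_mul, mul_pow, Complex.norm_real, Real.norm_eq_abs, sq_abs]
  rw [e, e]; ring

lemma kinE_scale (N : ℕ) (α : ℝ) (Ω : Set Plane) {Ψ : Config N → ℂ} (h : Differentiable ℝ Ψ)
    (c : ℝ) : kinE N α Ω (fun x => (c : ℂ) * Ψ x) = c ^ 2 * kinE N α Ω Ψ := by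
  unfold kinE
  rw [Finset.mul_sum]
  refine Finset.sum_congr rfl fun j _ => ?_
  simp only [DSq_scale N α j h c, integral_const_mul]

lemma normSq_scale (N : ℕ) (Ω : Set Plane) (Ψ : Config N → ℂ)
    (c : ℝ) : normSq N Ω (fun x => (c : ℂ) * Ψ x) = c ^ 2 * normSq N Ω Ψ := by
  unfold normSq
  rw [← integral_const_mul]
  congr 1
  funext x
  rw [norm_mul, mul_pow, Complex.norm_real, Real.norm_eq_abs, sq_abs]

/-- Variational principle for unnormalised trial functions. -/
lemma variational (N : ℕ) (α : ℝ) (Ω : Set Plane) {Ψ : Config N → ℂ} (hA : Admissible N Ψ)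
    (hc : IsCompact (tsupport Ψ)) (hs : tsupport Ψ ⊆ cube N Ω) {Z B : ℝ} (hZ : 0 < Z)
    (hn : normSq N Ω Ψ = Z) (hk : kinE N α Ω Ψ ≤ B * Z) : dirichletE N α Ω ≤ B := by
  have hd : Differentiable ℝ Ψ := hA.smooth.differentiable (by simp)
  set c : ℝ := (√Z)⁻¹ with hcdef
  have hc2 : c ^ 2 * Z = 1 := by
    rw [hcdef, inv_pow, Real.sq_sqrt hZ.le]; field_simp
  have hts : tsupport (fun x => (c : ℂ) * Ψ x) ⊆ tsupport Ψ := by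
    refine closure_mono fun x hx => ?_
    simp only [Function.mem_support] at hx ⊢
    exact right_ne_zero_of_mul hx
  have hmem : kinE N α Ω (fun x => (c : ℂ) * Ψ x) ∈ {E | ∃ Ψ : Config N → ℂ, Admissible N Ψ ∧
      IsCompact (tsupport Ψ) ∧ tsupport Ψ ⊆ cube N Ω ∧ normSq N Ω Ψ = 1 ∧ E = kinE N α Ω Ψ} := by
    refine ⟨_, ⟨contDiff_const.mul hA.smooth, fun σ x => ?_, ?_⟩,
      hc.of_isClosed_subset (isClosed_tsupport _) hts, hts.trans hs, ?_, rfl⟩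
    · rw [hA.symm σ x]
    · obtain ⟨U, hU, hdU, h0⟩ := hA.vanishes
      exact ⟨U, hU, hdU, fun x hx => by rw [h0 x hx, mul_zero]⟩
    · rw [normSq_scale, hn, hc2]
  refine (csInf_le ⟨0, ?_⟩ hmem).trans ?_
  · rintro _ ⟨Φ, -, -, -, -, rfl⟩
    exact kinE_nonneg _ _ _ _
  · rw [kinE_scale N α Ω hd]
    calc c ^ 2 * kinE N α Ω Ψ ≤ c ^ 2 * (B * Z) := by gcongr
      _ = B * (c ^ 2 * Z) := by ring
      _ = B := by rw [hc2, mul_one]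

lemma trial_bound {m : ℕ} (hm : 1 ≤ m) {a β R K : ℝ} (ha : 0 ≤ a) (haβ : a ≤ β) (hβ : 0 < β)
    (hR : 0 < R) (hK0 : 0 ≤ K) (hK : ∀ x : ℝ, |deriv Real.smoothTransition x| ≤ K)
    (hRm : R ≤ 2 / m) {N : ℕ} (hNR : N * (4 * R ^ 2) ≤ 1 / 18) :
    ED N (2 * a) ≤ N * (18 * (4 * (32 * π * K * m) ^ 2 +
        16 * (N * (8 * π * (K + 1) ^ 2 * β ^ 2 * (2 / (m * R) + 1 / β)) +
          N ^ 2 * (18 * (8 * π * (K + 1) * β / m) ^ 2)))) := by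
  have hpi := Real.pi_pos
  have hm0 : (0:ℝ) < m := by exact_mod_cast hm
  set B := 18 * (4 * (32 * π * K * m) ^ 2 +
        16 * (N * (8 * π * (K + 1) ^ 2 * β ^ 2 * (2 / (m * R) + 1 / β)) +
          N ^ 2 * (18 * (8 * π * (K + 1) * β / m) ^ 2))) with hB
  have hB0 : 0 ≤ B := by positivity
  set Z := ∫⁻ x, Wf m a β R (Finset.univ : Finset (Fin N)) x ∂nuN N with hZ
  have hZ0 : Z ≠ 0 := Z_pos hm hβ hR hNR _
  have hZt : Z ≠ ⊤ := Z_fin _ _ _ _ _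
  refine variational N (2 * a) Q0 (Phi_admissible hm ha haβ hβ hR hK N) (Phi_compact m a β R N)
    ((Phi_tsupport m a β R N).trans ?_) (ENNReal.toReal_pos hZ0 hZt) ?_ ?_
  · exact Set.pi_mono fun _ _ => Gp_subset m
  · unfold normSq
    rw [nuN_eq, integral_eq_lintegral_of_nonneg_ae
      (Filter.Eventually.of_forall fun x => by positivity)
      ((meas_Phi hβ hR _).norm.pow_const 2).aestronglyMeasurable]
    rfl
  · unfold kinE
    rw [nuN_eq]
    have hj : ∀ j : Fin N, ∫ x, DSq N (2 * a) j (Phi m a β R Finset.univ) x ∂nuN N ≤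
        B * Z.toReal := by
      intro j
      have h1 := kin_one hm ha haβ hβ hR hK0 hK hRm hNR j
      rw [← hB, ← hZ] at h1
      have h2 := enorm_integral_le_lintegral_enorm (μ := nuN N)
        (fun x => DSq N (2 * a) j (Phi m a β R Finset.univ) x)
      simp only [Real.enorm_eq_ofReal (DSq_nonneg _ _ _ _ _)] at h2
      rw [Real.enorm_eq_ofReal (integral_nonneg fun _ => DSq_nonneg _ _ _ _ _)] at h2
      have h3 := h2.trans h1
      rw [ENNReal.ofReal_le_iff_le_toReal (ENNReal.mul_ne_top ENNReal.ofReal_ne_top hZt),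
        ENNReal.toReal_mul, ENNReal.toReal_ofReal hB0] at h3
      exact h3
    calc _ ≤ ∑ _j : Fin N, B * Z.toReal := Finset.sum_le_sum fun j _ => hj j
      _ = _ := by simp; ring

lemma final_bound {K : ℝ} (hK1 : 1 ≤ K) (hK : ∀ x : ℝ, |deriv Real.smoothTransition x| ≤ K)
    {α : ℝ} (h0 : 0 ≤ α) (h1 : α ≤ 1) {N : ℕ} (hN : 1 ≤ N) :
    ED N α ≤ 18 * (16 * (32 * π * K) ^ 2 +
      16 * (152 * π * (K + 1) ^ 2 + 18 * (8 * π * (K + 1)) ^ 2)) * (N + α * N ^ 2) := by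
  have hpi := Real.pi_pos
  have hN1 : (1:ℝ) ≤ N := by exact_mod_cast hN
  have hN0 : (0:ℝ) < N := by linarith
  set β := max α (1 / (N:ℝ)) with hβd
  have hβ : 0 < β := lt_max_of_lt_right (by positivity)
  have hβ1 : β ≤ 1 := max_le h1 (by rw [div_le_one hN0]; exact hN1)
  have hαβ : α ≤ β := le_max_left _ _
  have hβs : β ≤ α + 1 / N := max_le (by have : 0 < 1 / (N:ℝ) := by positivity
                                         linarith) (by linarith)
  set s := (N:ℝ) * β with hs
  have hs1 : 1 ≤ s := by
    have : 1 / (N:ℝ) ≤ β := le_max_right _ _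
    rw [div_le_iff₀ hN0] at this
    rw [hs]; linarith
  have hsN : s ≤ N := by rw [hs]; nlinarith
  set m := ⌈√s⌉₊ with hmd
  have hq1 : 1 ≤ √s := Real.one_le_sqrt.2 hs1
  have hqs : √s ^ 2 = s := Real.sq_sqrt (by linarith)
  have hml : √s ≤ m := Nat.le_ceil _
  have hmu : (m:ℝ) ≤ 2 * √s := by
    have := Nat.ceil_lt_add_one (Real.sqrt_nonneg s)
    linarith
  have hm0 : (0:ℝ) < m := by linarith
  have hm : 1 ≤ m := by exact_mod_cast hm0
  have hms : s ≤ (m:ℝ) ^ 2 := by rw [← hqs]; gcongr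
  have hms4 : (m:ℝ) ^ 2 ≤ 4 * s := by nlinarith
  set R := 1 / √(72 * N) with hRd
  have hR : 0 < R := by positivity
  have hR2 : R ^ 2 = 1 / (72 * N) := by
    rw [hRd, div_pow, Real.sq_sqrt (by positivity)]; norm_num
  have hNR : N * (4 * R ^ 2) ≤ 1 / 18 := by
    rw [hR2]; apply le_of_eq; field_simp; norm_num
  have hRm : R ≤ 2 / m := by
    rw [le_div_iff₀ hm0]
    refine (abs_le_of_sq_le_sq' ?_ (by norm_num)).2
    rw [mul_pow, hR2, div_mul_eq_mul_div, div_le_iff₀ (by positivity)]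
    nlinarith
  have hb9 : β / (m * R) ≤ 9 := by
    refine (abs_le_of_sq_le_sq' ?_ (by norm_num)).2
    rw [div_pow, mul_pow, hR2, div_le_iff₀ (by positivity)]
    have : β ^ 2 * (72 * N) ≤ 9 ^ 2 * (m:ℝ) ^ 2 := by
      have : β * s ≤ s := by nlinarith
      nlinarith
    calc β ^ 2 = β ^ 2 * (72 * N) * (1 / (72 * N)) := by field_simp
      _ ≤ 9 ^ 2 * (m:ℝ) ^ 2 * (1 / (72 * N)) := by gcongr
      _ = _ := by ring
  have hG2 : β ^ 2 * (2 / (m * R) + 1 / β) ≤ 19 * β := by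
    have e : β ^ 2 * (2 / (m * R) + 1 / β) = β * (2 * (β / (m * R)) + 1) := by field_simp
    rw [e]; nlinarith
  have hG1 : (β / m) ^ 2 ≤ β / N := by
    rw [div_pow, div_le_div_iff₀ (by positivity) hN0]
    nlinarith
  have hK0 : 0 ≤ K := by linarith
  have hmain := trial_bound hm (a := α / 2) (β := β) (R := R) (K := K) (N := N) (by linarith)
    (by linarith) hβ hR hK0 hK hRm hNR
  rw [show 2 * (α / 2) = α by ring] at hmain
  refine hmain.trans ?_
  calc _ = (N:ℝ) * (18 * (4 * (32 * π * K) ^ 2 * (m:ℝ) ^ 2 +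
        16 * (N * (8 * π * (K + 1) ^ 2 * (β ^ 2 * (2 / (m * R) + 1 / β))) +
          N ^ 2 * (18 * (8 * π * (K + 1)) ^ 2 * (β / m) ^ 2)))) := by ring
    _ ≤ (N:ℝ) * (18 * (4 * (32 * π * K) ^ 2 * (4 * s) +
        16 * (N * (8 * π * (K + 1) ^ 2 * (19 * β)) +
          N ^ 2 * (18 * (8 * π * (K + 1)) ^ 2 * (β / N))))) := by gcongr
    _ = 18 * (16 * (32 * π * K) ^ 2 +
      16 * (152 * π * (K + 1) ^ 2 + 18 * (8 * π * (K + 1)) ^ 2)) * (β * N ^ 2) := by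
        rw [hs]; field_simp; ring
    _ ≤ _ := by
        gcongr
        calc β * (N:ℝ) ^ 2 ≤ (α + 1 / N) * N ^ 2 := by gcongr
          _ = _ := by field_simp; ring

/-- There exists a constant `C > 0` such that for every `α ∈ [0,1]` and every
integer `N ≥ 1`, the Dirichlet ground-state energy of `N` ideal anyons on the unit square
satisfies `E^D_N(α) ≤ C (N + α N²)`. -/
theorem dirichlet_global_upper_bound :
    ∃ C : ℝ, 0 < C ∧ ∀ α ∈ Set.Icc (0 : ℝ) 1, ∀ N : ℕ, 1 ≤ N →
      ED N α ≤ C * ((N : ℝ) + α * (N : ℝ) ^ 2) := by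
  obtain ⟨K, hK1, hK⟩ := smT_deriv_bound
  have hpi := Real.pi_pos
  exact ⟨18 * (16 * (32 * π * K) ^ 2 +
      16 * (152 * π * (K + 1) ^ 2 + 18 * (8 * π * (K + 1)) ^ 2)), by positivity,
    fun α hα N hN => final_bound hK1 hK hα.1 hα.2 hN⟩
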